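/- arXiv:1907.12963 — 2 statements merged into one kernel-verified Lean document; each statement's English description precedes it below -/
import Mathlib

section
/- There is exactly one pair of complementary equienergetic graphs of order 7: there exists a 7-vertex graph D with D not isomorphic to D̄ and E(D) = E(D̄), such that every 7-vertex graph G satisfying G not isomorphic to Ḡ and E(G) = E(Ḡ) is isomorphic to D or to D̄. -/
open Polynomial

/-- Adjacency matrix over ℝ, using classical instances. -/
noncomputable def adjMat {V : Type*} [Finite V] (G : SimpleGraph V) : Matrix V V ℝ :=
  letI := Fintype.ofFinite V
  letI := Classical.decEq V
  letI := Classical.decRel G.Adj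
  G.adjMatrix ℝ

/-- The energy of a graph: the sum of the absolute values of the eigenvalues of its
adjacency matrix (equivalently, of the roots of its characteristic polynomial, with
multiplicity, which all are real since the matrix is real symmetric). -/
noncomputable def energy {V : Type*} [Finite V] (G : SimpleGraph V) : ℝ :=
  letI := Fintype.ofFinite V
  letI := Classical.decEq V
  (((adjMat G).charpoly).roots.map (fun x => |x|)).sum

/-! ### Graphs encoded by natural numbers -/

namespace GraphCode

/-- The `k`-th binary digit of `c`. -/
def bit (c k : ℕ) : Bool := Nat.beq (Nat.mod (Nat.div c (Nat.pow 2 k)) 2) 1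

/-- Position of the pair `i < j` in the binary encoding of a graph. -/
def pairIndex (i j : ℕ) : ℕ := Nat.add (Nat.div (Nat.mul j (Nat.sub j 1)) 2) i

/-- Adjacency of `i` and `j` in the graph encoded by `c`. -/
def adj (c i j : ℕ) : Bool :=
  Bool.rec (Bool.rec false (bit c (pairIndex j i)) (Nat.blt j i)) (bit c (pairIndex i j))
    (Nat.blt i j)

/-- The image of `i` under the map whose values are the octal digits of `s`. -/
def digit (s i : ℕ) : ℕ := Nat.mod (Nat.div s (Nat.pow 8 i)) 8

def allBelow (p : ℕ → Bool) (n : ℕ) : Bool :=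
  Nat.rec true (fun k b => Bool.rec false b (p k)) n

/-- The digits of `s` give an isomorphism from the graph coded by `c` to the one coded by `d`. -/
def isoCheck (n c d s : ℕ) : Bool :=
  allBelow (fun j => Nat.blt (digit s j) n && allBelow (fun i =>
    Bool.rec (Bool.rec (Bool.rec true false (adj d (digit s i) (digit s j)))
      (adj d (digit s i) (digit s j)) (adj c i j)) false (Nat.beq (digit s i) (digit s j))) j) n

/-- The code of the graph coded by `c`, relabelled by the digits of `s`. -/
def relabel (n c s : ℕ) : ℕ :=
  Nat.rec 0 (fun j acc => Nat.rec acc (fun i acc' =>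
    Bool.rec acc' (Nat.add acc' (Nat.pow 2 (Bool.rec (pairIndex (digit s j) (digit s i))
      (pairIndex (digit s i) (digit s j)) (Nat.blt (digit s i) (digit s j))))) (adj c i j)) j) n

def fullCode (n : ℕ) : ℕ := 2 ^ pairIndex 0 n - 1

/-- Every element of the first list passes the test with the corresponding witness. -/
def zipAll (f : ℕ → ℕ → Bool) : List ℕ → List ℕ → Bool
  | [], _ => true
  | _ :: _, [] => false
  | x :: l, y :: m => f x y && zipAll f l m

/-- Every one-vertex extension of a listed graph by a neighbourhood in `nbhds` is isomorphic to a
graph satisfying `mem`. -/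
def extensionCheck (n : ℕ) (nbhds : List ℕ) (mem : ℕ → Bool) (data : List (ℕ × List ℕ)) : Bool :=
  data.all fun p => Nat.blt p.1 (2 ^ pairIndex 0 n) &&
    zipAll (fun S s =>
      let c := p.1 ||| S <<< pairIndex 0 n
      let d := relabel (n + 1) c s
      isoCheck (n + 1) c d s && mem d) nbhds p.2

def memKeys (data : List (ℕ × List ℕ)) (c : ℕ) : Bool := data.any fun p => Nat.beq p.1 c

/-- Search trees of graph codes with energy certificates. -/
inductive Tree
  | e : Tree
  | n : Tree → ℕ → List ℕ → List ℕ → Tree → Tree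

namespace Tree

def mem (c : ℕ) : Tree → Bool
  | e => false
  | n l x _ _ r => cond (Nat.beq c x) true (cond (Nat.blt c x) (mem c l) (mem c r))

def all (p : ℕ → List ℕ → List ℕ → Bool) : Tree → Bool
  | e => true
  | n l x u v r => p x u v && (all p l && all p r)

end Tree

/-! ### Power sums -/

/-- The rows of the adjacency matrix of the graph on seven vertices coded by `c`. -/
def rows (c : ℕ) : List (List Bool) :=
  [[false, bit c 0, bit c 1, bit c 3, bit c 6, bit c 10, bit c 15],
    [bit c 0, false, bit c 2, bit c 4, bit c 7, bit c 11, bit c 16],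
    [bit c 1, bit c 2, false, bit c 5, bit c 8, bit c 12, bit c 17],
    [bit c 3, bit c 4, bit c 5, false, bit c 9, bit c 13, bit c 18],
    [bit c 6, bit c 7, bit c 8, bit c 9, false, bit c 14, bit c 19],
    [bit c 10, bit c 11, bit c 12, bit c 13, bit c 14, false, bit c 20],
    [bit c 15, bit c 16, bit c 17, bit c 18, bit c 19, bit c 20, false]]

/-- The sum of the entries of the second list selected by the first list. -/
def selectSum (bs : List Bool) : List ℕ → ℕ :=
  List.rec (fun _ => 0) (fun b _ ih m =>
    List.rec 0 (fun r rs _ => Bool.rec (ih rs) (Nat.add r (ih rs)) b) m) bs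

/-- The product of a `0`-`1` matrix with a matrix whose rows are numbers written in
base `2 ^ 20`. -/
def mulRows (A : List (List Bool)) (B : List ℕ) : List ℕ := A.map fun r => selectSum r B

/-- The sum of the `i`-th digits of the `i`-th rows. -/
def traceRows (B : List ℕ) : ℕ :=
  List.rec (fun _ => 0)
    (fun r _ ih x => Nat.add (Nat.mod (Nat.div r x) 1048576) (ih (Nat.mul x 1048576))) B 1

/-- Traces of `A * B, …, A ^ k * B`, scaled by `4096 * M`, …, `4096 ^ k * M`. -/
def scaledTraces (A : List (List Bool)) : ℕ → ℕ → List ℕ → List ℕ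
  | 0, _, _ => []
  | k + 1, M, B =>
    Nat.mul (Nat.mul 4096 M) (traceRows (mulRows A B)) ::
      scaledTraces A k (Nat.mul 4096 M) (mulRows A B)

/-- The power sums of the scaled eigenvalues of the graph coded by `c`. -/
def powerSums (c : ℕ) : List ℕ :=
  scaledTraces (rows c) 7 1
    [1, 1048576, 1099511627776, 1152921504606846976, 1208925819614629174706176,
      1267650600228229401496703205376, 1329227995784915872903807060280344576]

def dot (c : List ℤ) : List ℕ → ℤ :=
  List.rec (fun _ => 0) (fun c _ ih p => List.rec 0 (fun p ps _ =>
    Int.add (Int.mul c (Int.ofNat p)) (ih ps)) p) c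

/-- The coefficients, from the constant coefficient upwards, of the monic polynomial of degree `k`
whose roots have the given power sums. -/
def newton (ps : List ℕ) : ℕ → List ℤ
  | 0 => [1]
  | k + 1 => (-dot (newton ps k) ps / (k + 1 : ℕ)) :: newton ps k

/-- Newton's identities. -/
def newtonCheck (ps : List ℕ) : List ℤ → Bool
  | [] => false
  | [c] => decide (c = 1)
  | c :: d :: l =>
    decide (((l.length + 1 : ℕ) : ℤ) * c + dot (d :: l) ps = 0) && newtonCheck ps (d :: l)

/-! ### Counting roots -/

/-- The coefficients of `c + (X + t) * s`. -/
def mulAdd (t c : ℕ) (s : List ℕ) : List ℕ :=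
  List.rec (fun c => [c]) (fun a _ ih c => Nat.add c (Nat.mul t a) :: ih a) s c

/-- The coefficients of `p (X + t)`. -/
def shift (t : ℕ) (p : List ℕ) : List ℕ :=
  List.rec [] (fun c _ s => mulAdd t c s) p

def compareSign (a b : ℕ) : SignType := cond (Nat.blt a b) .neg (cond (Nat.blt b a) .pos .zero)

/-- The signs of the coefficients of a difference of polynomials, prepended in reverse order. -/
def signs (p q : List ℕ) : List SignType → List SignType :=
  List.rec (fun _ acc => acc) (fun a _ ih q acc => List.rec acc (fun b q _ =>
    ih q (compareSign a b :: acc)) q) p q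

/-- The number of sign changes of a list following a given sign. -/
def changes : SignType → List SignType → ℕ
  | _, [] => 0
  | s, .zero :: l => changes s l
  | .pos, .neg :: l => changes .neg l + 1
  | .neg, .pos :: l => changes .pos l + 1
  | _, .pos :: l => changes .pos l
  | _, .neg :: l => changes .neg l

/-- Changes the signs of every other entry. -/
def alternate : List SignType → List SignType
  | [] => []
  | [s] => [s]
  | s :: t :: l => s :: (match t with | .pos => .neg | .neg => .pos | .zero => .zero) :: alternate l

/-- Upper bound for the number of positive roots of `p - q`. -/
def upper (p q : List ℕ) : ℕ := changes .zero (signs p q [])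

/-- Lower bound for the number of nonnegative roots of `p - q`. -/
def lower (p q : List ℕ) : ℕ := Nat.sub 7 (changes .zero (alternate (signs p q [])))

/-- Whether the sum of the positive roots of `p - q` is shown to be at most `n` by the increments
of a sequence of thresholds. -/
def upperCheck : List ℕ → ℕ → List ℕ → List ℕ → Bool
  | [], _, p, q => Nat.beq (upper p q) 0
  | d :: ds, n, p, q =>
    Nat.ble (Nat.mul (upper p q) d) n &&
      upperCheck ds (Nat.sub n (Nat.mul (upper p q) d)) (shift d p) (shift d q)

/-- A lower bound for the sum of the positive roots of `p - q` from the increments of a sequence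
of thresholds. -/
def lowerSum : List ℕ → List ℕ → List ℕ → ℕ
  | [], _, _ => 0
  | d :: ds, p, q =>
    Nat.add (Nat.mul (lower (shift d p) (shift d q)) d) (lowerSum ds (shift d p) (shift d q))

def positivePart (c : List ℤ) : List ℕ := c.map Int.toNat

def negativePart (c : List ℤ) : List ℕ := c.map fun z => (-z).toNat

def coeffs (c : ℕ) : List ℤ := newton (powerSums c) 7

/-- Whether the energy of the graph coded by `c` is shown to be less than that of its
complement. -/
def energyCheck (c : ℕ) (us ls : List ℕ) : Bool :=
  newtonCheck (powerSums c) (coeffs c) &&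
    (newtonCheck (powerSums (c ^^^ 2097151)) (coeffs (c ^^^ 2097151)) &&
      (let p := coeffs (c ^^^ 2097151)
       let n := lowerSum ls (positivePart p) (negativePart p)
       Nat.blt 0 n &&
         upperCheck us (Nat.sub n 1) (positivePart (coeffs c)) (negativePart (coeffs c))))

set_option maxRecDepth 100000

def extensionData0 : List (ℕ × List ℕ) :=
  [(0, [0])]

def extensionData1 : List (ℕ × List ℕ) :=
  [(0, [8, 8])]

def extensionData2 : List (ℕ × List ℕ) :=
  [(0, [136, 129, 136, 136]), (1, [17, 66, 80, 136])]

def extensionData3 : List (ℕ × List ℕ) :=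
  [(0, [1672, 1602, 1616, 1553, 1672, 1665, 1672, 1672]), (4, [720, 1672, 1112, 1616, 1224, 1672,
  1672, 1672]), (6, [209, 706, 720, 1672, 1224, 1217, 1224, 1672]), (7, [209, 139, 153, 538, 209,
  706, 720, 1672])]

def extensionData4 : List (ℕ × List ℕ) :=
  [(0, [18056, 17475, 17496, 16922, 17608, 17090, 17104, 16593, 18056, 17986, 18000, 17937,
  18056, 18049, 18056, 18056]), (12, [2257, 4308, 5666, 8739, 5890, 8963, 17104, 16523, 6352,
  17986, 10328, 17433, 10440, 17601, 18056, 18056]), (30, [2257, 1116, 1123, 8739, 1809, 1291,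
  1305, 8291, 2257, 2187, 2201, 8739, 10440, 10433, 10440, 18056]), (32, [10440, 18049, 18056,
  18056, 13576, 17601, 17608, 17608, 14472, 18049, 18056, 18056, 18056, 18049, 18056, 18056]),
  (44, [2257, 5379, 6296, 18056, 5890, 8963, 9992, 17601, 6352, 10433, 10328, 18056, 10440,
  13569, 14472, 18056]), (48, [6352, 14402, 10328, 18000, 10440, 18056, 18056, 18056, 14472,
  14402, 14416, 18000, 14472, 18056, 18056, 18056]), (52, [6352, 6352, 5792, 13408, 5904, 13576,
  8984, 17104, 6352, 14472, 10328, 18000, 10440, 18056, 18056, 18056]), (56, [2257, 10307, 10328,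
  14353, 10440, 14465, 14472, 18056, 14472, 14402, 14416, 14353, 14472, 14465, 14472, 18056]),
  (60, [2257, 2187, 6296, 10265, 6352, 10433, 6352, 18056, 6352, 14472, 10328, 14416, 10440,
  14472, 14472, 18056]), (62, [2257, 1676, 1697, 1123, 1809, 5890, 5904, 13576, 2257, 6338, 6352,
  14472, 10440, 10433, 10440, 18056]), (63, [2257, 1676, 1697, 1123, 1809, 1291, 1305, 4378,
  2257, 2187, 2201, 6170, 2257, 6338, 6352, 18056])]

def extensionData5 : List (ℕ × List ℕ) :=
  [(0, [181896, 177220, 177248, 172579, 177416, 172803, 172824, 168218, 178312, 174147, 174168,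
  170010, 174280, 170178, 170192, 166097, 181896, 181315, 181336, 180762, 181448, 180930, 180944,
  180433, 181896, 181826, 181840, 181777, 181896, 181889, 181896, 181896]), (160, [55504, 181896,
  71912, 169632, 82776, 176912, 107360, 172824, 84568, 178256, 109152, 174168, 174280, 174280,
  169632, 169632, 88264, 181896, 181336, 181336, 120072, 181448, 176912, 176912, 120968, 181896,
  178256, 178256, 181896, 181896, 181896, 181896]), (224, [22737, 54916, 54944, 180762, 120072,
  119554, 119568, 180433, 120968, 120898, 120912, 181777, 153224, 181889, 181896, 181896, 88264,
  152643, 152664, 180762, 120072, 152258, 152272, 180433, 120968, 153154, 153168, 181777, 153224,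
  181889, 181896, 181896]), (236, [22737, 8989, 10347, 34476, 17739, 45396, 9059, 69917, 19097,
  10844, 47650, 71723, 15121, 103748, 105120, 164963, 22737, 21708, 22177, 107052, 55042, 82755,
  119568, 172299, 55504, 120898, 84568, 174105, 88264, 181441, 181896, 181896]), (368, [22737,
  47748, 54944, 181896, 18257, 71492, 78688, 177416, 51906, 84547, 117328, 178305, 80641, 142017,
  174280, 174273, 55504, 120898, 88152, 181896, 87816, 181441, 152776, 181448, 120968, 117314,
  120912, 181896, 120968, 178305, 181896, 181896]), (432, [55504, 55504, 46376, 107304, 46432,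
  107360, 107360, 107360, 51920, 117384, 47776, 174168, 47888, 174280, 103776, 169240, 55504,
  120968, 54944, 181336, 55056, 181448, 107360, 172824, 120968, 120968, 120912, 181840, 120968,
  181896, 181896, 181896]), (496, [22737, 22667, 54944, 119904, 55056, 120072, 78688, 180944,
  55504, 120898, 88152, 153168, 88264, 153224, 153224, 181896, 55504, 120898, 54944, 152664,
  55056, 152776, 86808, 180944, 120968, 120898, 120912, 153168, 120968, 153224, 153224, 181896]),
  (504, [22737, 22667, 22681, 55322, 22737, 55490, 55504, 181896, 19153, 84547, 84568, 117265,
  84680, 117377, 117384, 178312, 22737, 88131, 88152, 120849, 88264, 120961, 120968, 181896,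
  120968, 120898, 120912, 120849, 120968, 120961, 120968, 181896]), (508, [22737, 8989, 18089,
  8940, 18257, 9052, 13665, 69987, 19153, 19083, 15009, 47650, 15121, 47874, 43800, 170192,
  22737, 22667, 22177, 54818, 22289, 55042, 54552, 180944, 55504, 120968, 88152, 120912, 88264,
  120968, 120968, 181896]), (512, [120968, 181826, 181840, 181777, 181896, 181889, 181896,
  181896, 146056, 178242, 178256, 178193, 178312, 178305, 178312, 178312, 153224, 181826, 181840,
  181777, 181896, 181889, 181896, 181896, 181896, 181826, 181840, 181777, 181896, 181889, 181896,
  181896]), (672, [55504, 120898, 80480, 178256, 87816, 181896, 181896, 181896, 84568, 145937,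
  109152, 178256, 117384, 178312, 178256, 178256, 88264, 153217, 120912, 181840, 120072, 181896,
  181896, 181896, 120968, 181896, 146000, 178256, 153224, 181896, 181896, 181896]), (736, [22737,
  88131, 88152, 153105, 87816, 152769, 152776, 181896, 120968, 120898, 120912, 181777, 120968,
  153217, 153224, 181896, 88264, 120898, 120912, 153105, 120072, 152769, 152776, 181896, 120968,
  120898, 120912, 181777, 153224, 153217, 153224, 181896]), (748, [22737, 18061, 14442, 43051,
  18250, 50499, 55056, 181896, 19097, 14932, 47650, 72227, 51920, 84673, 80480, 178256, 22737,
  22156, 55448, 88089, 55042, 86787, 87816, 181896, 55504, 120898, 84568, 145937, 88264, 153217,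
  120968, 181896]), (768, [88264, 152643, 152664, 181896, 120072, 181441, 181448, 181448, 120968,
  181889, 181896, 181896, 181896, 181889, 181896, 181896, 153224, 152643, 152664, 181896, 152776,
  181441, 181448, 181448, 153224, 181889, 181896, 181896, 181896, 181889, 181896, 181896]), (800,
  [88264, 88257, 88264, 181896, 83784, 144705, 144712, 177416, 84680, 146049, 146056, 178312,
  109320, 174273, 174280, 174280, 88264, 153217, 153224, 181896, 120072, 181441, 181448, 181448,
  120968, 181889, 181896, 181896, 181896, 181889, 181896, 181896]), (801, [22737, 50821, 50856,
  181896, 18257, 46404, 46432, 177416, 19153, 47748, 47776, 178312, 109320, 105218, 105232,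
  174280, 22737, 54916, 54944, 181896, 120072, 119554, 119568, 181448, 120968, 120898, 120912,
  181896, 181896, 181889, 181896, 181896]), (880, [22737, 51843, 55448, 120849, 88264, 84673,
  88264, 181896, 51906, 84547, 117328, 145986, 84673, 146049, 117384, 178305, 55504, 120898,
  88152, 153168, 88264, 120961, 153224, 181896, 120968, 117314, 120912, 181896, 120968, 146049,
  153224, 181896]), (884, [22737, 15114, 54944, 54944, 18257, 47426, 50520, 144712, 19153, 47874,
  51864, 146056, 80648, 109313, 80648, 174280, 55504, 55504, 54944, 119904, 55056, 120072, 86808,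
  181448, 55504, 120968, 88152, 181896, 88264, 181896, 153224, 181896]), (896, [55504, 152643,
  119904, 152090, 120072, 152258, 152272, 180944, 120968, 153154, 153168, 181840, 153224, 181896,
  181896, 181896, 153224, 152643, 152664, 152090, 152776, 152258, 152272, 180944, 153224, 153154,
  153168, 181840, 153224, 181896, 181896, 181896]), (908, [22737, 21204, 18089, 86563, 18257,
  86787, 46432, 180944, 51920, 51920, 47776, 181840, 47888, 181896, 72472, 181896, 22737, 53460,
  87648, 119330, 87816, 119554, 152272, 180944, 55504, 153154, 88152, 181840, 88264, 181896,
  181896, 181896]), (928, [55504, 88257, 54944, 153224, 87816, 120065, 119568, 181448, 88264,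
  120961, 120912, 181896, 88264, 181896, 181896, 181896, 88264, 153217, 153224, 153224, 120072,
  152769, 152776, 181448, 120968, 153217, 153224, 181896, 153224, 181896, 181896, 181896]), (944,
  [55504, 55504, 50856, 88152, 51024, 88264, 46432, 181896, 51920, 117384, 84568, 146000, 84680,
  146056, 146056, 178312, 55504, 120968, 88152, 153168, 88264, 153224, 153224, 181896, 120968,
  120968, 120912, 181840, 120968, 181896, 181896, 181896]), (948, [55504, 55504, 50856, 50856,
  51024, 51024, 46432, 107360, 51920, 51920, 47776, 109152, 47888, 109320, 72472, 170192, 55504,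
  55504, 54944, 119904, 55056, 120072, 86808, 180944, 55504, 120968, 88152, 181840, 88264,
  181896, 181896, 181896]), (960, [22737, 119876, 119904, 152090, 120072, 152258, 152272, 151761,
  120968, 153154, 153168, 153105, 153224, 153217, 153224, 181896, 153224, 152643, 152664, 152090,
  152776, 152258, 152272, 151761, 153224, 153154, 153168, 153105, 153224, 153217, 153224,
  181896]), (972, [22737, 21204, 22114, 86563, 22282, 86787, 86808, 151691, 22737, 88131, 88152,
  152601, 88264, 152769, 153224, 181896, 22737, 53460, 54818, 86563, 55042, 86787, 152272,
  151691, 55504, 153154, 88152, 152601, 88264, 152769, 153224, 181896]), (990, [22737, 17501,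
  17515, 13420, 18257, 13644, 13665, 45228, 19153, 14988, 15009, 46124, 15121, 47874, 47888,
  181896, 22737, 21596, 21603, 86563, 22289, 21771, 21785, 86115, 22737, 22667, 22681, 86563,
  88264, 88257, 88264, 181896]), (992, [22737, 54916, 54944, 153224, 87816, 119554, 119568,
  152776, 88264, 120898, 120912, 153224, 88264, 153217, 153224, 181896, 88264, 153217, 153224,
  153224, 120072, 152769, 152776, 152776, 120968, 153217, 153224, 153224, 153224, 153217, 153224,
  181896]), (1004, [22737, 21708, 22177, 21603, 18250, 50499, 55056, 119554, 19153, 55490, 51864,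
  120912, 88264, 87809, 88264, 181896, 22737, 54531, 55448, 153224, 55042, 86787, 87816, 152769,
  55504, 88257, 88152, 153224, 88264, 120065, 120968, 181896]), (1008, [22737, 22667, 54944,
  88089, 55056, 88257, 54552, 153224, 55504, 120898, 88152, 120849, 88264, 120961, 120968,
  181896, 55504, 120898, 88152, 153168, 88264, 153224, 153224, 153224, 120968, 120898, 120912,
  153168, 120968, 153224, 153224, 181896]), (1012, [22737, 22737, 54944, 54944, 55056, 55056,
  54552, 86808, 55504, 55504, 55448, 88152, 55504, 88264, 55504, 181896, 55504, 55504, 54944,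
  119904, 55056, 120072, 86808, 152272, 55504, 120968, 88152, 153168, 88264, 153224, 153224,
  181896]), (1016, [22737, 22667, 22681, 55322, 22737, 55490, 55504, 120968, 19153, 84547, 84568,
  117265, 84680, 117377, 117384, 146056, 22737, 88131, 88152, 120849, 88264, 120961, 120968,
  153224, 120968, 120898, 120912, 120849, 120968, 120961, 120968, 181896]), (1020, [22737, 22667,
  18089, 18026, 18257, 18250, 55504, 55504, 19153, 19083, 51864, 84505, 51920, 84673, 51920,
  146056, 22737, 22667, 55448, 88089, 55504, 88257, 55504, 153224, 55504, 120968, 88152, 120912,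
  88264, 120968, 120968, 181896]), (1022, [22737, 18061, 18089, 13420, 18257, 13644, 13665, 9059,
  19153, 14988, 15009, 10851, 15121, 47874, 47888, 109320, 22737, 22156, 22177, 21603, 22289,
  55042, 55056, 120072, 22737, 55490, 55504, 120968, 88264, 88257, 88264, 181896]), (1023,
  [22737, 18061, 18089, 13420, 18257, 13644, 13665, 9059, 19153, 14988, 15009, 10851, 15121,
  11019, 11033, 35610, 22737, 22156, 22177, 21603, 22289, 21771, 21785, 53530, 22737, 22667,
  22681, 55322, 22737, 55490, 55504, 181896])]

def extensionData6 : List (ℕ × List ℕ) :=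
  [(0, [1754760, 1717317, 1717352, 1679916, 1717576, 1680196, 1680224, 1718920, 1681988, 1682016,
  1682184, 1726088, 1692740, 1692768, 1692936, 1693832, 1754760, 1750084, 1750112, 1750280,
  1751176, 1754760]), (1184, [219345, 284886, 428274, 1083061, 442778, 1094037, 1151402, 445466,
  1096725, 1154090, 1682184, 452802, 1107589, 1692768, 1172290, 1174082, 481488, 1750084,
  1250984, 1258320, 1260112, 1267336]), (3440, [219345, 71526, 78708, 275765, 107436, 361893,
  369068, 183435, 146573, 85099, 142667, 190617, 92253, 157353, 157017, 420378, 219345, 207053,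
  214249, 214865, 477890, 481488]), (3840, [219345, 975380, 975394, 1466906, 1004808, 1266370,
  1266384, 1005704, 1267266, 1267280, 1525384, 713251, 975380, 975394, 1237201, 1238545, 743624,
  1266755, 1266776, 1004808, 1005704, 1267336]), (3872, [219345, 481474, 481488, 1754760, 182161,
  439684, 439712, 183505, 441476, 441504, 929096, 190673, 452228, 452256, 943432, 944776, 743624,
  547057, 547022, 739144, 740040, 743624]), (3873, [219345, 1661128, 1661121, 879368, 1745443,
  682584, 682563, 1744995, 680792, 680771, 991788, 1737827, 662872, 662851, 988204, 987308,
  1595601, 846608, 846594, 575029, 573685, 559349]), (4608, [743624, 1754753, 1754760, 1754760,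
  874888, 1656641, 1656648, 961800, 1714881, 1714888, 1158472, 976136, 1725633, 1725640, 1172808,
  1693832, 1005704, 1754753, 1754760, 1750280, 1260168, 1267336]), (5792, [219345, 386309,
  473256, 1754760, 153482, 873348, 644000, 183505, 703556, 961632, 671048, 452354, 648004,
  975632, 943425, 682689, 481488, 1005634, 735840, 739144, 1002120, 743624]), (6656, [481488,
  1525314, 738920, 1750112, 739144, 1750280, 1745688, 1260168, 1521730, 1256024, 1256136,
  1267336, 1525314, 1266776, 1266888, 1525384, 1005704, 1525314, 1520736, 1520904, 1260168,
  1267336]), (6816, [481488, 481488, 371504, 858928, 382368, 873376, 575400, 441504, 961632,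
  662760, 372064, 452368, 976136, 386344, 680792, 420560, 481488, 1005704, 473256, 477008,
  739928, 743624]), (7672, [219345, 107366, 107380, 107317, 107436, 107429, 107436, 183505,
  146573, 146601, 146769, 190673, 157325, 157353, 157521, 158417, 219345, 214669, 214697, 214865,
  215761, 219345]), (7680, [219345, 738885, 738920, 1516067, 739144, 1516291, 1516312, 1260168,
  1256003, 1256024, 1256136, 1267336, 1266755, 1266776, 1266888, 1525384, 1005704, 1520708,
  1520736, 1520904, 1260168, 1267336]), (7840, [219345, 219275, 473256, 993321, 477008, 1000769,
  406952, 477848, 1260049, 961632, 736008, 481488, 1267329, 743008, 976136, 1005704, 481488,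
  1005634, 473256, 477008, 739928, 743624]), (7904, [219345, 218764, 218785, 144501, 156506,
  680267, 680281, 215642, 739851, 739865, 743624, 190225, 451780, 451808, 976136, 714952, 219345,
  480900, 480928, 743176, 1005704, 743624]), (7916, [219345, 46438, 105140, 71925, 119700, 82845,
  46508, 179298, 105637, 142443, 1688085, 190218, 123669, 1677445, 157003, 158417, 219345,
  1619240, 211050, 214858, 215705, 219345]), (8048, [219345, 109326, 120113, 46389, 182161,
  108941, 116137, 183498, 441476, 183449, 146762, 190673, 190603, 452256, 157521, 158417, 219345,
  477827, 481432, 214865, 477890, 481488]), (8112, [219345, 219345, 144753, 1450694, 144809,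
  1450526, 406952, 183505, 183505, 404712, 404824, 190673, 190673, 419048, 419160, 420560,
  481488, 1590925, 1357062, 1356838, 477904, 481488]), (11008, [481488, 1005634, 681576, 1726032,
  739144, 1754760, 1754760, 445648, 1457288, 871528, 929096, 714840, 1238538, 975968, 1238216,
  944720, 743624, 1267266, 1266776, 1004808, 1002120, 1267336]), (12032, [219345, 742980, 743008,
  1266202, 739144, 1524929, 1524936, 740040, 1002050, 1002064, 994056, 1005704, 1266755, 1266776,
  1266888, 1005704, 743624, 1266755, 1266776, 1004808, 1002120, 1267336]), (12192, [219345,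
  190603, 480928, 714777, 477008, 743169, 476504, 183449, 416787, 408744, 441616, 190673, 714819,
  714840, 714504, 682584, 481488, 743617, 480928, 743176, 477904, 743624]), (13056, [743624,
  743617, 743624, 1754760, 670600, 1158017, 1158024, 671048, 1158465, 1158472, 1158472, 714952,
  1238657, 1238664, 681800, 682696, 743624, 1267329, 1267336, 739144, 740040, 1267336]), (13057,
  [219345, 444038, 444080, 1266202, 146321, 371077, 371112, 146769, 371973, 372008, 1158472,
  190673, 419461, 419496, 681800, 682696, 219345, 476805, 476840, 739144, 740040, 1267336]),
  (14164, [219345, 109326, 181937, 181363, 146314, 371588, 109473, 146762, 372036, 109921,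
  408898, 190673, 190092, 452256, 157521, 158417, 219345, 218764, 480928, 214865, 215761,
  481488]), (14208, [219345, 452228, 480928, 1266202, 743176, 975618, 1004304, 743624, 976962,
  1005648, 743624, 452802, 975940, 1238104, 976129, 977025, 481488, 1266755, 1004640, 1004808,
  1005704, 1267336]), (14220, [219345, 120078, 178353, 140917, 117642, 80269, 1415190, 146769,
  1356082, 109865, 146769, 190218, 156877, 1443414, 419650, 1118453, 219345, 1327858, 214697,
  1091118, 477904, 219345]), (14240, [219345, 452802, 481488, 1679909, 182161, 415618, 444304,
  183505, 416962, 445648, 671048, 452802, 452802, 1410150, 681793, 682689, 481488, 1324148,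
  481488, 739144, 740040, 743624]), (14241, [219345, 88270, 174321, 1679909, 182161, 83853,
  141225, 183505, 85197, 142569, 146769, 190666, 419461, 1410150, 1152046, 1151150, 219345,
  1324148, 476840, 1094709, 1093813, 219345]), (14560, [219345, 214669, 174321, 427700, 181657,
  737611, 406952, 183449, 739851, 408744, 408912, 452816, 1084755, 452256, 714504, 714952,
  219345, 480900, 476840, 738136, 739928, 743624]), (14728, [219345, 213717, 174321, 733292,
  174489, 733516, 661416, 445648, 1002050, 404712, 404824, 190673, 1004612, 714336, 714504,
  420560, 219345, 1004612, 476840, 477008, 477904, 1005704]), (15104, [481488, 743617, 480928,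
  1525384, 739144, 1258817, 1258824, 740040, 1260161, 1260168, 929096, 743624, 1267329, 1266776,
  1004808, 1005704, 743624, 1267329, 1266776, 739144, 740040, 1267336]), (15232, [481488, 481488,
  480928, 1004640, 481040, 1004808, 742168, 481488, 1005704, 743512, 743624, 452816, 1238664,
  975968, 976136, 977032, 481488, 1267336, 1004640, 1004808, 1005704, 1267336]), (15240, [219345,
  219275, 408744, 743449, 408912, 743617, 372064, 445648, 445648, 408744, 408912, 190673, 714819,
  714840, 714952, 420560, 219345, 743491, 743512, 743624, 477904, 1005704]), (15264, [481488,
  481488, 371504, 371504, 444304, 444304, 371112, 445648, 445648, 372008, 408912, 452816, 714952,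
  452256, 419664, 420560, 481488, 743624, 480928, 477008, 477904, 743624]), (15584, [219345,
  214669, 214697, 991788, 213850, 733516, 733537, 215642, 735756, 735777, 736008, 219345,
  1004612, 1004640, 1004808, 1005704, 219345, 551145, 551117, 475482, 477722, 743624]), (15856,
  [219345, 219275, 177457, 172788, 177569, 172956, 144809, 183505, 183435, 179361, 179473,
  190673, 190603, 1353478, 1353254, 452816, 219345, 1589973, 214249, 214361, 215761, 481488]),
  (16096, [219345, 218764, 218785, 481306, 218897, 480515, 480536, 215642, 739851, 739865,
  740040, 190673, 743491, 743512, 714504, 856373, 219345, 1062257, 1062222, 743176, 477722,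
  743624]), (16128, [219345, 480900, 480928, 1525384, 739144, 1258817, 1258824, 740040, 1260161,
  1260168, 994056, 743624, 1266755, 1266776, 1004808, 1005704, 743624, 1266755, 1266776, 739144,
  740040, 1267336]), (16256, [219345, 218764, 480928, 1004066, 481040, 1004290, 742168, 481488,
  1005634, 743512, 743624, 481488, 1266755, 1004640, 1004808, 1005704, 481488, 1266755, 1004640,
  1004808, 1005704, 1267336]), (16268, [219345, 217812, 178353, 1587341, 178577, 1587285,
  1390662, 1589973, 1589973, 1590477, 1590365, 1579221, 1579221, 1382598, 1382430, 1344798,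
  1587341, 1587341, 1325198, 1325142, 1589973, 1317078]), (16288, [219345, 219338, 480928,
  1586277, 477008, 739137, 476504, 477904, 740033, 477848, 736008, 481488, 743617, 1345190,
  743176, 743624, 481488, 1586277, 1324134, 477008, 477904, 743624]), (16320, [219345, 218764,
  218785, 741923, 218897, 742147, 742168, 219345, 743491, 743512, 743624, 190673, 975940, 975968,
  976136, 977032, 219345, 1004612, 1004640, 1004808, 1005704, 1267336]), (16332, [219345,
  1607522, 1608404, 1608026, 1608348, 1607914, 1608404, 1607011, 1607522, 1607445, 1607333,
  1607522, 1607522, 1608404, 1608348, 1607011, 1578850, 1578850, 1579732, 1579676, 1578339,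
  1607522]), (16350, [219345, 1681512, 1681477, 144501, 1681953, 1681512, 1681477, 1679713,
  1680168, 1680133, 146769, 1738401, 1709736, 1709701, 1710618, 1708378, 1595041, 1623720,
  1623685, 1624602, 1622362, 219345]), (16352, [219345, 218764, 218785, 218211, 218897, 480515,
  480536, 219345, 481411, 481432, 743624, 190673, 1607340, 1607333, 714504, 714952, 219345,
  1578668, 1578661, 743176, 743624, 743624]), (16364, [219345, 144718, 146097, 1679909, 182154,
  1679916, 1679909, 183505, 1679468, 1679461, 1679909, 1672293, 1671852, 1672293, 1676325,
  1675436, 1586277, 1585836, 1586277, 1618981, 1618092, 1607333]), (16368, [219345, 219275,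
  218785, 1642781, 218897, 1642725, 480536, 183505, 183435, 1417486, 1417318, 190673, 1639197,
  1409814, 1409702, 1380638, 219345, 1581853, 1323798, 1323686, 1351966, 481488]), (16372,
  [219345, 1717317, 1717317, 1717317, 1717261, 1717261, 1455174, 1716365, 1716365, 1454726,
  1454614, 1705613, 1705613, 1447558, 1447446, 1446102, 1590925, 1590925, 1361542, 1361430,
  1360086, 1607893]), (16384, [1267336, 1754179, 1754200, 1753626, 1754312, 1753794, 1753808,
  1754760, 1754690, 1754704, 1754760, 1468040, 1725507, 1725528, 1725640, 1726088, 1525384,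
  1754179, 1754200, 1754312, 1754760, 1754760]), (17568, [219345, 419461, 476840, 1753626,
  442778, 877380, 992096, 445466, 879172, 993888, 1517768, 452802, 1172549, 1238104, 942914,
  944706, 481488, 1266755, 1258600, 1000272, 1002064, 1267336]), (19824, [219345, 181902, 152306,
  115381, 181146, 144277, 405930, 183435, 707651, 1095045, 1152053, 190617, 157269, 157353,
  854644, 420378, 219345, 214669, 797580, 214865, 477890, 481488]), (20224, [219345, 975380,
  975394, 1237530, 1004808, 1266370, 1266384, 1005704, 1267266, 1267280, 1267336, 713251, 975380,
  975394, 1237201, 1238545, 743624, 1266755, 1266776, 1004808, 1005704, 1267336]), (20236,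
  [219345, 152222, 152691, 647724, 182154, 144781, 177569, 183505, 179340, 146601, 736008,
  189539, 417949, 418859, 156499, 158298, 219345, 214221, 214697, 476994, 477904, 219345]),
  (20256, [219345, 481474, 481488, 1267336, 739144, 1000769, 1000776, 740040, 1002113, 1002120,
  736008, 190673, 452228, 452256, 976136, 977032, 743624, 743617, 743624, 739144, 740040,
  743624]), (20257, [219345, 153230, 153265, 1064273, 181146, 1607851, 1607837, 183386, 1606955,
  1606941, 1148021, 189539, 156765, 156779, 418138, 420378, 219345, 476805, 476840, 214865,
  215761, 559349]), (20992, [743624, 1266755, 1266776, 1754760, 943432, 1725633, 1725640,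
  1002120, 1754753, 1754760, 1754760, 976136, 1467074, 1467088, 1172808, 1238664, 1005704,
  1525314, 1525328, 1266888, 1260168, 1267336]), (22176, [219345, 451780, 480928, 1267280,
  419650, 680771, 942928, 477904, 1002050, 739928, 740040, 452354, 713475, 975632, 943425,
  714945, 481488, 1005634, 743512, 743176, 1002120, 743624]), (22288, [219345, 481411, 480928,
  1266713, 477008, 739137, 742168, 445634, 445571, 1002064, 703745, 190673, 714308, 975968,
  714504, 977032, 481488, 1005634, 743008, 739144, 740040, 1005704]), (23040, [481488, 1266755,
  1004640, 1524761, 1004808, 1524929, 1524432, 1002120, 1521730, 1521744, 1521800, 1267336,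
  1266755, 1266776, 1266888, 1267336, 1005704, 1525314, 1266776, 1266888, 1260168, 1267336]),
  (23200, [481488, 481488, 444080, 1004640, 415128, 942928, 644000, 445592, 1002064, 703584,
  740040, 452368, 976136, 419048, 680792, 714952, 481488, 1005704, 476840, 743176, 739928,
  743624]), (24056, [219345, 180950, 180978, 1608474, 181146, 1608418, 1608404, 183505, 1607522,
  1607508, 1607340, 190673, 190092, 190113, 190225, 158417, 219345, 218764, 218785, 218897,
  215761, 219345]), (24064, [219345, 1004612, 1004640, 1524250, 1004808, 1524418, 1524432,
  1002120, 1521730, 1521744, 1521800, 1267336, 1266755, 1266776, 1266888, 1267336, 1005704,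
  1266755, 1266776, 1266888, 1260168, 1267336]), (24224, [219345, 219275, 476840, 1004640,
  477008, 1004801, 738136, 477848, 1001994, 735840, 740040, 481488, 1267329, 743008, 976136,
  1005704, 481488, 1056083, 476840, 743176, 739928, 743624]), (24288, [219345, 218764, 218785,
  741923, 190225, 713475, 713496, 219345, 743491, 743512, 743624, 190225, 451780, 451808, 976136,
  1344931, 219345, 480900, 480928, 1318051, 1005704, 743624]), (24300, [219345, 152278, 181874,
  144501, 1579676, 1579746, 1579732, 1607011, 1607522, 1607508, 1606892, 190218, 1608026,
  1608467, 1608348, 1607011, 219345, 1579354, 1579795, 1579676, 1578339, 1608026]), (24432,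
  [219345, 219275, 190113, 1607340, 214865, 476994, 419160, 183498, 445571, 1606885, 1152053,
  190673, 1345715, 452256, 1115765, 1114869, 219345, 1317043, 1578661, 1058421, 477890, 481488]),
  (24496, [219345, 219345, 476840, 1378062, 477008, 1377894, 406952, 477904, 1377054, 1410318,
  1410150, 190673, 190673, 1378062, 1377894, 452816, 481488, 1579221, 1317078, 1317022, 477904,
  481488]), (24576, [1005704, 1520708, 1520736, 1754641, 1520904, 1754753, 1754760, 1260168,
  1751106, 1751120, 1751176, 1267336, 1754690, 1754704, 1754760, 1754760, 1525384, 1520708,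
  1520736, 1520904, 1521800, 1525384]), (25088, [1005704, 1005634, 1005648, 1754641, 1005704,
  1754753, 1754760, 969864, 1457218, 1457232, 1457288, 977032, 1467970, 1467984, 1468040,
  1174152, 1005704, 1525314, 1525328, 1525384, 1260168, 1267336]), (25092, [481488, 1005704,
  706160, 1754704, 706440, 1754760, 1754760, 445648, 1457288, 670824, 671048, 452816, 1468040,
  681576, 681800, 1174152, 481488, 1525384, 738920, 739144, 1260168, 1267336]), (25760, [219345,
  743491, 473256, 1517089, 477008, 1520897, 992096, 445466, 707595, 993888, 1256136, 452802,
  714819, 1266776, 1004808, 944706, 481488, 1005634, 993384, 1000776, 1002064, 1005704]), (26116,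
  [219345, 214669, 738920, 1258537, 739144, 1258817, 1319710, 477904, 1256003, 993888, 994056,
  481488, 1266755, 1004640, 1004808, 1005704, 481488, 542633, 738920, 739144, 1260168, 1267336]),
  (26272, [219345, 682563, 739928, 969745, 743624, 977025, 1005704, 445466, 678923, 707609,
  969864, 452802, 682563, 976976, 714945, 944706, 481488, 1005634, 739928, 743624, 1002064,
  1005704]), (26276, [219345, 158347, 178353, 408114, 182161, 415618, 472416, 183449, 445466,
  670824, 408912, 190673, 452802, 419496, 681800, 420560, 481488, 481488, 473256, 477008, 477848,
  481488]), (27298, [219345, 219275, 146097, 1083222, 444304, 1642725, 406952, 183449, 445459,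
  408744, 1380582, 190673, 452739, 387240, 419664, 420560, 219345, 481411, 473256, 477008,
  477904, 743624]), (27392, [481488, 1005634, 714336, 1238041, 743176, 1266881, 1266384, 1005704,
  1005634, 976976, 1005704, 714840, 1238538, 975968, 1238216, 976976, 743624, 1267266, 1266776,
  1004808, 1005704, 1267336]), (27424, [481488, 743617, 420504, 944720, 739144, 739137, 739144,
  445648, 969857, 679000, 703752, 452816, 977025, 682584, 714504, 944776, 743624, 743617, 743624,
  739144, 740040, 743624]), (28016, [219345, 211596, 218785, 481306, 214865, 468804, 472416,
  183435, 707651, 1061781, 1355942, 190617, 1054634, 714840, 1345204, 1581916, 219345, 1058729,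
  1062285, 1581797, 1057693, 1054123]), (28260, [219345, 211085, 214697, 1316770, 214858, 472388,
  1581853, 183386, 179284, 441378, 1351924, 190673, 190092, 452256, 743176, 452816, 219345,
  211085, 1316252, 476994, 215761, 481488]), (28416, [219345, 742980, 743008, 1266202, 743176,
  1266370, 1266384, 1005704, 1005634, 1005648, 1005704, 1005704, 1266755, 1266776, 1266888,
  1005704, 743624, 1266755, 1266776, 1004808, 1005704, 1267336]), (28448, [219345, 481474,
  481488, 1005704, 739144, 739137, 739144, 740040, 1002113, 1002120, 736008, 743624, 1005697,
  1005704, 743176, 1005704, 743624, 1319668, 1319654, 739144, 740040, 743624]), (28449, [219345,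
  1581867, 1581853, 1329041, 1581804, 1581804, 1581797, 183386, 1581867, 1581853, 1089781,
  190554, 1578283, 1578269, 1082613, 1118453, 1581804, 1324449, 1324428, 1057525, 795445,
  791861]), (28528, [219345, 183435, 190617, 1581916, 219345, 1639148, 1642725, 183435, 1642795,
  1614109, 1642725, 190617, 1606955, 1639197, 1639148, 1118446, 219345, 1578339, 1581916,
  1581797, 1089886, 1082739]), (28532, [219345, 183435, 1614109, 1614109, 1642725, 1642725,
  1425550, 183505, 1642725, 1388814, 1417318, 1639141, 1639141, 1639197, 1409702, 1380582,
  1581853, 1581853, 1323798, 1581797, 1351966, 1606885]), (28576, [219345, 190603, 480928,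
  714777, 481040, 1606885, 480536, 477904, 976962, 707672, 743624, 190673, 714819, 1083222,
  714504, 977032, 481488, 1578269, 480928, 743176, 743624, 743624]), (28594, [219345, 1642781,
  181937, 1642781, 1642725, 1642725, 1413398, 1642781, 1642781, 1413398, 1380582, 1639197,
  1639197, 1409814, 1376998, 1380638, 1581853, 1581853, 1319710, 1581797, 1351966, 1344798]),
  (28672, [743624, 1520708, 1520736, 1516067, 1258824, 1516291, 1516312, 1260168, 1517635,
  1517656, 1517768, 1267336, 1524803, 1524824, 1524936, 1525384, 1525384, 1520708, 1520736,
  1520904, 1521800, 1525384]), (28832, [481488, 743617, 469224, 1513120, 444304, 1258824, 992096,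
  445648, 1260168, 993888, 671048, 714952, 714945, 714952, 681800, 682696, 481488, 1525384,
  727272, 1000776, 1002120, 743624]), (29184, [743624, 1005634, 1005648, 1525265, 739144,
  1525377, 1525384, 1002120, 1260098, 1260112, 1256136, 1005704, 1267266, 1267280, 1266888,
  1005704, 1005704, 1525314, 1525328, 1525384, 1260168, 1267336]), (29440, [743624, 743617,
  743624, 1267336, 706440, 1004801, 1004808, 707784, 1005697, 1005704, 671048, 714952, 1238657,
  1238664, 976136, 977032, 743624, 1267329, 1267336, 1004808, 1005704, 1267336]), (29441,
  [219345, 480900, 480928, 1607340, 182161, 742147, 742168, 183505, 743491, 743512, 671048,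
  190673, 975940, 975968, 976136, 977032, 219345, 1004612, 1004640, 1004808, 1005704, 1267336]),
  (29472, [743624, 743617, 743624, 1155637, 706440, 706433, 706440, 707784, 707777, 707784,
  671048, 714952, 714945, 714952, 681800, 682696, 743624, 743617, 743624, 739144, 740040,
  743624]), (29473, [219345, 1679916, 1679909, 1679916, 1155637, 1155637, 1155630, 1155189,
  1155189, 1155182, 1155637, 1148021, 1148021, 1148014, 1152053, 1151157, 1062005, 1062005,
  1061998, 1094709, 1093813, 1083061]), (29856, [219345, 480900, 469224, 1513120, 477008,
  1258306, 992096, 477904, 1260098, 993888, 994056, 743624, 1267329, 1266776, 1004808, 1005704,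
  481488, 1267329, 727272, 1000776, 1002120, 743624]), (30128, [219345, 219345, 472360, 472360,
  477008, 477008, 472416, 183505, 445634, 473760, 441616, 190673, 452802, 480928, 452368, 682696,
  481488, 481488, 472360, 477008, 477904, 481488]), (30368, [219345, 481411, 477848, 1002001,
  743176, 743169, 743176, 477904, 1002050, 739928, 740040, 452802, 452739, 1005648, 714497,
  1005704, 481488, 1319668, 739928, 743176, 1002120, 743624]), (30548, [219345, 218764, 218785,
  1607340, 182154, 1345715, 1607333, 183498, 1344819, 1606885, 408898, 190673, 190092, 452256,
  1345204, 1344756, 219345, 218764, 480928, 1316532, 1316084, 481488]), (30580, [219345, 1607340,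
  1679909, 1679909, 1679909, 1644076, 1679909, 1679461, 1642732, 1679461, 1417766, 1607340,
  1607340, 1672293, 1152046, 1151150, 1578668, 1578668, 1586277, 1094702, 1093806, 1345204]),
  (30581, [219345, 1607340, 1679909, 1679909, 1679909, 1644076, 1679909, 1679461, 1642732,
  1679461, 1679909, 1607340, 1607340, 1672293, 1676325, 1675429, 1578668, 1578668, 1586277,
  1618981, 1618085, 1607340]), (30592, [219345, 452228, 480928, 1266202, 743176, 975618, 1004304,
  743624, 976962, 1005648, 743624, 452802, 975940, 1238104, 976129, 977025, 481488, 1266755,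
  1004640, 1004808, 1005704, 1267336]), (30604, [219345, 1578220, 1607333, 1607333, 153482,
  1578668, 1378398, 183505, 1319731, 1606885, 1607333, 190218, 1606892, 1345694, 1377894,
  1082613, 219345, 1316147, 1578661, 1054382, 1319668, 1083054]), (30624, [219345, 452802,
  481488, 1607333, 743176, 714497, 743176, 743624, 714945, 743624, 743624, 452802, 1083061,
  1345190, 714497, 714945, 481488, 1316532, 1054382, 743176, 743624, 743624]), (30625, [219345,
  1578668, 1607333, 1607333, 182161, 1320564, 1377894, 183505, 1319668, 1376998, 146769, 1607333,
  1607340, 1345190, 1115758, 1114862, 1578668, 1316532, 1578661, 1058421, 1057525, 1083054]),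
  (30640, [219345, 1642725, 1642725, 1642725, 477008, 682689, 477008, 183505, 1380582, 1380582,
  1155182, 190673, 1376998, 1376998, 1148014, 1380582, 481488, 1581797, 1319654, 1061998,
  1089774, 1082606]), (30644, [219345, 1679909, 1450526, 1450526, 1417766, 1417766, 1450526,
  1417318, 1417318, 1450078, 1417766, 1410150, 1410150, 1442910, 1414182, 1413286, 1586277,
  1586277, 1324134, 1356838, 1355942, 1345190]), (30720, [481488, 1520708, 1258600, 1516067,
  1258824, 1516291, 1516312, 1260168, 1517635, 1517656, 1517768, 1267336, 1524803, 1524824,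
  1524936, 1525384, 1525384, 1520708, 1520736, 1520904, 1521800, 1525384]), (30880, [481488,
  1583309, 469224, 1250984, 476504, 1258320, 992096, 477848, 1260112, 993888, 994056, 481488,
  1267336, 1004640, 1004808, 1005704, 481488, 1525384, 727272, 738136, 739928, 743624]), (30944,
  [219345, 218764, 480928, 1004066, 481040, 1320550, 738136, 481488, 1319654, 739928, 1061998,
  452816, 1084755, 452256, 714504, 714952, 219345, 1317078, 797454, 1004808, 1005704, 743624]),
  (30956, [219345, 205597, 178353, 1587341, 182161, 1590869, 1325198, 183449, 1589917, 146601,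
  1328222, 190673, 1579221, 1321166, 157521, 1581797, 219345, 1587341, 1325198, 1328726, 1327774,
  1317078]), (31088, [219345, 215754, 480928, 1586277, 182161, 473410, 439712, 183505, 1323686,
  1327774, 703752, 452816, 1578661, 452256, 419664, 420560, 219345, 477890, 1327774, 477008,
  740040, 481488]), (31112, [219345, 218764, 214697, 741923, 214865, 742147, 734048, 477904,
  1005634, 739928, 740040, 190673, 1004612, 714336, 714504, 977032, 219345, 1004612, 743008,
  743176, 477904, 1005704]), (31152, [481488, 481488, 439600, 439600, 439712, 439712, 406952,
  445648, 445648, 408744, 408912, 452816, 452816, 419496, 419664, 420560, 481488, 481488, 472360,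
  472416, 477904, 481488]), (31232, [481488, 1005634, 738920, 1525265, 739144, 1525377, 1525384,
  1002120, 1260098, 1256024, 1256136, 1005704, 1267266, 1266776, 1266888, 1005704, 1005704,
  1525314, 1525328, 1525384, 1260168, 1267336]), (31392, [481488, 481488, 473256, 735840, 477008,
  743176, 472416, 445592, 1002064, 703584, 740040, 452816, 1005704, 743512, 714504, 1005704,
  481488, 1005704, 735840, 743176, 739928, 743624]), (31488, [481488, 743617, 480928, 1266776,
  739144, 1004801, 1004304, 740040, 1005697, 1005648, 736008, 743624, 1267329, 1266776, 1004808,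
  1005704, 743624, 1267329, 1266776, 1004808, 1005704, 1267336]), (31520, [481488, 1586277,
  481488, 1324134, 739144, 739137, 739144, 740040, 740033, 740040, 736008, 743624, 743617,
  743624, 743176, 743624, 743624, 1061998, 1324134, 739144, 740040, 743624]), (31521, [219345,
  1586277, 1586277, 1586277, 182161, 1094702, 1324134, 183505, 1093806, 1323686, 1126958, 190673,
  1083054, 1316518, 1119790, 1118446, 1324134, 1324134, 1324134, 1061998, 1061550, 1054382]),
  (31616, [481488, 481488, 480928, 1004640, 481040, 1004808, 742168, 481488, 1005704, 743512,
  743624, 452816, 1238664, 975968, 976136, 977032, 481488, 1267336, 1004640, 1004808, 1005704,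
  1267336]), (31624, [219345, 219275, 481432, 743449, 481488, 743617, 481488, 445648, 1606941,
  445592, 445648, 190673, 714819, 714840, 714952, 420560, 219345, 743491, 743512, 743624, 477904,
  1005704]), (31628, [219345, 1607893, 1345750, 1345750, 1345694, 1345694, 1345750, 1606941,
  1606941, 1345302, 1345190, 1345750, 1345750, 1345750, 1345694, 1344798, 1317078, 1317078,
  1317078, 1317022, 1316126, 1345750]), (31648, [481488, 1607333, 480928, 1345190, 444304,
  1345190, 443800, 445648, 1344742, 445592, 743624, 452816, 1345190, 1345190, 714504, 714952,
  481488, 1316518, 1316518, 743176, 743624, 743624]), (31664, [481488, 1642781, 444080, 1380638,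
  444304, 1380582, 406952, 445648, 1380638, 1380638, 1380582, 452816, 1377054, 1377054, 1376998,
  420560, 481488, 1319710, 1319710, 1319654, 477904, 481488]), (31668, [1717317, 1717317,
  1455174, 1455174, 1455118, 1455118, 1455174, 1454222, 1454222, 1454726, 1454614, 1443470,
  1443470, 1447558, 1447446, 1446102, 1328782, 1328782, 1361542, 1361430, 1360086, 1345750]),
  (31744, [219345, 1258565, 1258600, 1516067, 1258824, 1516291, 1516312, 1260168, 1517635,
  1517656, 1517768, 1267336, 1524803, 1524824, 1524936, 1525384, 1525384, 1520708, 1520736,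
  1520904, 1521800, 1525384]), (31904, [219345, 214669, 469224, 1583309, 476504, 1590365, 992096,
  477848, 1589917, 993888, 808038, 481488, 1579221, 797454, 1004808, 1005704, 481488, 544089,
  797454, 808038, 807590, 793366]), (31968, [219345, 1579802, 1579795, 733740, 213850, 1579746,
  1579732, 215642, 1578850, 1578836, 1578668, 219345, 1056090, 1056083, 1579683, 1578339,
  1579802, 798049, 798028, 1058421, 1057525, 1056090]), (31980, [219345, 1586473, 1587341,
  1587537, 1590869, 1590953, 1587341, 1589994, 1586473, 1590477, 1594460, 1579354, 1582945,
  1583820, 1583197, 1581867, 1586473, 1586473, 1587341, 1590869, 1589994, 1579354]), (32112,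
  [219345, 1582700, 1586277, 1586277, 1586277, 1582700, 1586277, 215754, 1585836, 1585829,
  1324134, 219345, 1578668, 1578661, 1320564, 1581797, 1586277, 1582700, 1586277, 1061998,
  1323686, 1316532]), (32176, [219345, 219345, 472360, 472360, 472416, 472416, 472416, 477904,
  477904, 473760, 473872, 481488, 481488, 480928, 481040, 481488, 481488, 1586445, 472360,
  472416, 477904, 481488]), (32240, [219345, 219275, 1579221, 1579221, 1579165, 1579165, 1579221,
  215761, 1578269, 1578773, 1578661, 190673, 1579221, 1579221, 1579165, 1578269, 219345, 1579221,
  1320718, 1320550, 1319710, 1579221]), (32248, [219345, 219275, 219289, 1581923, 219345,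
  1581867, 1581853, 183505, 1581923, 1581916, 1581804, 190673, 1578339, 1578332, 1578220, 158417,
  219345, 1581923, 1581916, 1581804, 1581923, 1578339]), (32252, [219345, 1590925, 1590925,
  1590925, 1590869, 1590869, 1590925, 1589973, 1589973, 1590477, 1590365, 1579221, 1579221,
  1583309, 1583197, 1581853, 1590925, 1590925, 1590925, 1590869, 1589973, 1579221]), (32256,
  [219345, 738885, 738920, 1525265, 739144, 1525377, 1525384, 1002120, 1256003, 1256024, 1256136,
  1005704, 1266755, 1266776, 1266888, 1005704, 1005704, 1525314, 1525328, 1525384, 1260168,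
  1267336]), (32416, [219345, 219275, 473256, 735777, 477008, 743169, 472416, 477848, 1001994,
  735840, 740040, 481488, 1005634, 743512, 743176, 1005704, 481488, 1581797, 1054550, 1061550,
  739928, 743624]), (32480, [219345, 218764, 218785, 481306, 218897, 1578283, 1578269, 215642,
  1578339, 1578332, 1578220, 190673, 1345442, 1345428, 714504, 1344931, 219345, 1316770, 1316756,
  1578220, 1057525, 1316259]), (32492, [219345, 1581867, 1578332, 1578339, 1581804, 1581867,
  1581797, 1581867, 1581867, 1581916, 1581804, 1578339, 1578339, 1578332, 1578220, 1581867,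
  1581867, 1581867, 1578332, 1581804, 1581867, 1578339]), (32512, [219345, 480900, 480928,
  1266202, 739144, 1004290, 1004304, 740040, 1005634, 1005648, 736008, 743624, 1266755, 1266776,
  1004808, 1005704, 743624, 1316532, 1316518, 1004808, 1005704, 1267336]), (32544, [219345,
  1586284, 1586277, 1586284, 739144, 1324148, 1324134, 740040, 1323700, 1323686, 736008, 743624,
  1316532, 1316518, 743176, 743624, 743624, 1324148, 1324134, 1062005, 1061557, 1054389]),
  (32545, [1586284, 1586284, 1586277, 1586284, 1586284, 1586284, 1586277, 1585836, 1585836,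
  1585829, 1062005, 1578668, 1578668, 1578661, 1058421, 1057525, 1586284, 1586284, 1586277,
  1062005, 1061557, 1054389]), (32624, [219345, 1578220, 1581797, 1581797, 1581797, 1578220,
  1581797, 1581797, 1581804, 1581797, 1355942, 1578220, 1578220, 1578213, 1345204, 1118446,
  1581797, 1578220, 1581797, 1061998, 1319654, 1316084]), (32628, [1586277, 1586277, 1586277,
  1586277, 1586277, 1586277, 1360926, 1585829, 1585829, 1360030, 1389094, 1578661, 1578661,
  1578661, 1353254, 1351910, 1586277, 1586277, 1328222, 1324134, 1323686, 1578661]), (32640,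
  [219345, 218764, 480928, 1004066, 481040, 1004290, 742168, 481488, 1005634, 743512, 743624,
  481488, 1266755, 1004640, 1004808, 1005704, 481488, 1579221, 1004640, 1004808, 1005704,
  1267336]), (32652, [1579221, 1579221, 1579221, 1579221, 1579165, 1579165, 1317078, 1578269,
  1578269, 1578773, 1578661, 1579221, 1579221, 1345750, 1345694, 1344798, 1579221, 1579221,
  1317078, 1317022, 1578269, 1317078]), (32672, [219345, 1578661, 1578661, 1578661, 477008,
  1578661, 1316518, 477904, 1578213, 1316070, 1316518, 481488, 1345190, 1345190, 1345190,
  1344742, 1578661, 1578661, 1316518, 1058414, 1057518, 1316518]), (32688, [219345, 1581853,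
  1581853, 1581853, 1581797, 1581797, 1319710, 1351966, 1351966, 1351966, 1351910, 1344798,
  1344798, 1344798, 1344742, 1380638, 1581853, 1581853, 1319710, 1319654, 1319710, 1316126]),
  (32692, [1590925, 1590925, 1361542, 1361542, 1361430, 1361430, 1394246, 1360086, 1360086,
  1393350, 1393182, 1345750, 1345750, 1382598, 1382430, 1380638, 1590925, 1590925, 1328782,
  1328726, 1327830, 1317078]), (32704, [219345, 218764, 218785, 741923, 218897, 742147, 742168,
  219345, 743491, 743512, 743624, 190673, 1608474, 1608467, 1608355, 1607011, 219345, 1579802,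
  1579795, 1579683, 1578339, 1267336]), (32716, [1607522, 1607522, 1608404, 1608026, 1608348,
  1607914, 1608404, 1607011, 1607522, 1607445, 1607333, 1607522, 1607522, 1608404, 1608348,
  1607011, 1578850, 1578850, 1579732, 1579676, 1578339, 1607522]), (32734, [1607914, 1607914,
  1607893, 1608474, 1608355, 1607914, 1607893, 1607011, 1607466, 1607445, 1607340, 1607914,
  1607914, 1607893, 1608355, 1607011, 1579242, 1579242, 1579221, 1579683, 1578339, 1607914]),
  (32736, [219345, 1607340, 1607333, 1607340, 1607340, 1607340, 1607333, 1606892, 1606892,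
  1606885, 1607340, 1607340, 1607340, 1607333, 1607340, 1606892, 1578668, 1578668, 1578661,
  1578668, 1578220, 1607340]), (32748, [1607333, 1606892, 1607333, 1607333, 1607333, 1607340,
  1607333, 1606892, 1606892, 1606885, 1607333, 1607333, 1606892, 1607333, 1607333, 1606892,
  1578661, 1578220, 1578661, 1578661, 1578220, 1607333]), (32752, [219345, 1606941, 1606941,
  1606941, 1606885, 1606885, 1606941, 1606941, 1606941, 1606941, 1606885, 1606941, 1606941,
  1606941, 1606885, 1377054, 1578269, 1578269, 1578269, 1578213, 1319710, 1606941]), (32756,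
  [1607893, 1607893, 1607893, 1607893, 1607837, 1607837, 1419334, 1606941, 1606941, 1417990,
  1417766, 1607893, 1607893, 1378510, 1378398, 1377054, 1579221, 1579221, 1321166, 1321054,
  1319710, 1607893]), (32760, [1642851, 1642851, 1642844, 1642851, 1642732, 1642795, 1642781,
  1642851, 1642851, 1642844, 1642732, 1639267, 1639267, 1639260, 1639148, 1642851, 1581923,
  1581923, 1581916, 1581804, 1614179, 1607011]), (32764, [1642781, 1642781, 1642781, 1642781,
  1642725, 1642725, 1642781, 1642781, 1642781, 1642781, 1642725, 1639197, 1639197, 1639197,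
  1639141, 1642781, 1581853, 1581853, 1581853, 1581797, 1614109, 1606941]), (32766, [1679916,
  1679916, 1679909, 1679916, 1679916, 1679916, 1679909, 1679468, 1679468, 1679461, 1679916,
  1672300, 1672300, 1672293, 1676332, 1675436, 1586284, 1586284, 1586277, 1618988, 1618092,
  1607340]), (32767, [1754760, 1754760, 1754753, 1754760, 1754641, 1754704, 1754690, 1753297,
  1753808, 1753794, 1753626, 1738961, 1743056, 1743042, 1742874, 1741082, 1595601, 1628368,
  1628354, 1628186, 1626394, 1608474])]

def smallSets : List ℕ :=
  [0, 1, 2, 3, 4, 5, 6, 8, 9, 10, 12, 16, 17, 18, 20, 24, 32, 33, 34, 36, 40, 48]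

namespace Tree

/-- Representatives of the pairs of complementary graphs of order seven with different energies. -/
def energyPairs : Tree :=
  n (n (n (n (n (n (n (n (n (n e 0 [] [24576] e) 70144 [4096] [20480] e) 102176 [8192] [4096,
  12288] (n e 102912 [4096, 2048] [18432] e)) 104096 [5120, 3072] [3072, 13312] (n (n e 111360
  [8192] [4096, 12288] e) 119296 [4096, 2048, 2048] [2048, 16384] (n e 174848 [4096, 2048, 2048]
  [3072, 14336] e))) 188932 [3072, 4096, 1024] [2048, 15360] (n (n (n e 207616 [4096, 4096]
  [4096, 12288] e) 221184 [6144] [18432] (n e 221696 [8192] [18432] e)) 221700 [8192] [17408] (n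
  (n e 240384 [4096, 2048, 3072] [4096, 12288] e) 241408 [4096, 1024, 5120] [5120, 10240] (n e
  241568 [1152, 1408, 2432, 6912] [2432, 3584, 6912] e)))) 244616 [3072, 1024, 8192] [2048, 4096,
  6144] (n (n (n (n e 253952 [8192] [18432] e) 254464 [8192] [17408] (n e 255136 [2048, 2048,
  6144] [2048, 2048, 11264] e)) 255648 [2560, 2560, 5888] [2304, 768, 11264] (n (n e 255652
  [3328, 2560, 6016] [1664, 1024, 1408, 8832] e) 256768 [3072, 3072, 4096] [2048, 1024, 12288] (n
  e 256800 [2944, 2688, 6016] [2816, 640, 11008] e))) 258560 [1024, 6144, 2560] [2560, 14336] (n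
  (n (n e 278528 [4096] [20480] e) 348672 [2048, 6144] [2048, 16384] (n e 374656 [4096, 7168]
  [6144, 8192] e)) 380704 [2560, 3584, 5120] [2048, 2560, 9728] (n (n e 381440 [3072, 5120]
  [3072, 14336] e) 382624 [2048, 1024, 1024, 7168] [2048, 3072, 9216] (n e 386820 [4096, 1024,
  6144] [2560, 2048, 9216] e))))) 389888 [6656, 4608] [3584, 12288] (n (n (n (n (n (n e 409600
  [8192] [20480] e) 414208 [4096, 4096] [18432] e) 414209 [4096, 4096] [2048, 15360] (n e 441216
  [6144, 6144] [6144, 8192] e)) 449024 [5120, 4096] [2048, 14336] (n (n e 449184 [1536, 5120,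
  5120] [2048, 2048, 10240] e) 449296 [3072, 2048, 7168] [2048, 3072, 9216] (n e 453376 [2048,
  4096, 5120] [2048, 2048, 11264] e))) 454784 [2048, 4096, 4096] [4096, 12288] (n (n (n e 462592
  [2048, 4096, 4096] [4096, 12288] e) 473984 [12288] [8192] (n e 475136 [4096, 4096] [16384] e))
  476320 [3072, 3584, 2560] [3072, 13312] (n (n e 477448 [2048, 1024, 3072, 3072] [2048, 1024,
  13312] e) 478976 [5120, 5120] [2048, 2048, 11264] (n e 479744 [4096, 6144] [2048, 14336] e))))
  481792 [4096, 6144] [4096, 12288] (n (n (n (n e 481952 [4096, 8192] [4096, 8192] e) 486144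
  [3072, 8192] [4096, 11264] (n e 488192 [4096, 8192] [4096, 10240] e)) 488193 [1024, 4608, 6656]
  [5120, 9216] (n (n e 495360 [6144, 4096] [4096, 10240] e) 499424 [2560, 1536, 9216] [2048,
  5120, 4608] (n e 505728 [2048, 2048, 8192] [7168, 6144] e))) 506752 [4096, 10240] [8192, 4096]
  (n (n (n e 507776 [4096, 10240] [8192, 4096] e) 507840 [16384] [8192, 4096] (n e 507872 [2048,
  13824] [8192, 2048] e)) 507904 [4096, 4096] [16384] (n (n e 509088 [3072, 3072, 4096] [2048,
  1024, 12288] e) 511744 [4096, 8192] [4096, 10240] (n e 511776 [2688, 2816, 6784] [3072, 1024,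
  9344] e)))))) 512512 [3072, 2048, 5120] [2048, 14336] (n (n (n (n (n (n (n e 513696 [2048,
  1024, 512, 8704] [3584, 1024, 8704] e) 513808 [2688, 3200, 6272] [2816, 1792, 8832] e) 514560
  [4096, 6144] [2048, 2048, 10240] (n e 514720 [2048, 3072, 8192] [4096, 9216] e)) 515584 [4096,
  8192] [2048, 2048, 11264] (n (n e 515744 [3072, 1024, 9216] [4096, 512, 7680] e) 515808 [5120,
  9216] [4096, 1024, 6144] (n e 518912 [4608, 7168] [2048, 2560, 10240] e))) 519936 [3584, 9216]
  [2560, 2048, 9216] (n (n (n e 520960 [6144, 6144] [5120, 9216] e) 522112 [2560, 512, 10752]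
  [2048, 3072, 7680] (n e 522632 [6272, 7040] [1920, 3712, 6656] e)) 523008 [1536, 3072, 8704]
  [1024, 4096, 8704] (n (n e 523136 [4096, 10240] [6144, 6656] e) 575520 [4096, 4096] [18432] (n
  e 645664 [3072, 3072, 4096] [5120, 10240] e)))) 651264 [8192] [2048, 14336] (n (n (n (n e
  651424 [1536, 6144, 2560] [1024, 2048, 12544] e) 651536 [4096, 1536, 4608] [2560, 12800] (n e
  651776 [2048, 4096, 4096] [3072, 13312] e)) 679936 [4096, 4096] [16384] (n (n e 743944 [6144,
  6144] [6144, 8192] e) 745472 [8192] [18432] (n e 747616 [3072, 1024, 6144] [2048, 3072, 10240]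
  e))) 747784 [2560, 3072, 5120] [4608, 10752] (n (n (n e 750080 [2048, 3072, 6144] [4096, 12288]
  e) 765696 [3072, 2560, 5632] [2560, 1536, 10240] (n e 773664 [2048, 3072, 6144] [6144, 8192]
  e)) 777840 [3584, 10752] [8192, 2560] (n (n e 778240 [6144, 4096] [18432] e) 779424 [1280,
  1792, 1792, 6400] [2816, 1280, 10496] (n e 779780 [1536, 5584, 4016] [768, 3568, 10368] e)))))
  782848 [1536, 4096, 5120] [4096, 11776] (n (n (n (n (n e 784144 [1146, 1762, 261, 10480] [3458,
  1226, 8048] e) 784896 [1536, 3584, 6656] [4608, 10752] (n e 811008 [8192] [16384] e)) 811012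
  [8192] [4096, 12288] (n (n e 825856 [2048, 4096, 3072] [1024, 16384] e) 829696 [3072, 5120]
  [3072, 14336] (n e 843780 [4096, 6144] [4096, 12288] e))) 844964 [3072, 2048, 6144] [2048,
  4096, 7168] (n (n (n e 845924 [1792, 4608, 4608] [5632, 8448] e) 846080 [4096, 6144] [4096,
  12288] (n e 846112 [4096, 7168] [6144, 9216] e)) 848032 [3584, 1536, 5632] [4608, 11264] (n (n
  e 848388 [2560, 2816, 5888] [3840, 11776] e) 878880 [4096, 8192] [6144, 8192] (n e 880640
  [4096, 8192] [4096, 12288] e)))) 880800 [6144, 5120] [4096, 11264] (n (n (n (n e 881152 [1024,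
  3072, 7168] [3072, 13312] e) 881156 [3072, 1024, 8192] [2048, 1024, 12288] (n e 899840 [3072,
  1024, 8192] [2048, 2048, 10240] e)) 911648 [4096, 8192] [7168, 7168] (n (n e 912672 [4096,
  9216] [7168, 6144] e) 913184 [4864, 9216] [6912, 5888] (n e 913408 [6144, 4096] [4096, 12288]
  e))) 913568 [2048, 4352, 5120] [1792, 2560, 10496] (n (n (n e 913920 [1024, 4096, 7168] [3072,
  13312] e) 913924 [4096, 7680] [2560, 512, 11776] (n e 914592 [1280, 4608, 6656] [1536, 3584,
  8704] e)) 914948 [1152, 1408, 1536, 8512] [2496, 1792, 9600] (n (n e 915108 [2624, 704, 11328]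
  [4480, 576, 6208] e) 916224 [1536, 3072, 8704] [1536, 2560, 10240] (n e 924160 [1024, 5120,
  3072] [17408] e))))))) 929920 [6144, 4096] [4096, 12288] (n (n (n (n (n (n (n (n e 942080
  [4096, 8192] [4096, 12288] e) 946176 [12288] [16384] e) 946177 [4096, 8192] [4096, 12288] (n e
  946304 [4096, 8192] [4096, 12288] e)) 946688 [4096, 8192] [4096, 12288] (n (n e 946689 [2048,
  2048, 8192] [4096, 11264] e) 956928 [2048, 3584, 4608] [2560, 14336] (n e 958112 [704, 2496,
  1472, 7680] [704, 2048, 1664, 8960] e))) 962688 [3072, 2048, 5120] [4096, 12288] (n (n (n e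
  963984 [4096, 8192] [2048, 4096, 7168] e) 965000 [2944, 2432, 6912] [2560, 2304, 8448] (n e
  965376 [2048, 3072, 7168] [1024, 4096, 9216] e)) 965377 [2816, 2048, 7680] [2560, 2560, 8192]
  (n (n e 973312 [2048, 3072, 6144] [4096, 11264] e) 979028 [1536, 4096, 6656] [6656, 6656] (n e
  979072 [4096, 7168] [6144, 9216] e)))) 979104 [3072, 1024, 8192] [5632, 9216] (n (n (n (n e
  980368 [2048, 1536, 10240] [512, 6656, 5120] e) 980400 [3072, 12288] [2048, 4096, 5120] (n e
  980401 [3072, 12544] [1792, 6400, 1280] e)) 980992 [4096, 8192] [4096, 12288] (n (n e 981424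
  [4288, 11072] [2608, 2752, 6368] e) 981504 [2048, 2048, 8192] [4096, 11264] (n e 981760 [1024,
  3072, 9728] [1024, 3072, 10240] e))) 989696 [6144, 6144] [4096, 12288] (n (n (n e 990720 [1024,
  5632, 4096] [4096, 11776] e) 990880 [2532, 2550, 7766] [2530, 1832, 9210] (n e 995072 [1280,
  4608, 6144] [1024, 3328, 10496] e)) 997440 [5120, 6144] [5120, 10240] (n (n e 997600 [1024,
  4864, 6912] [2048, 2560, 8704] e) 997768 [1536, 3584, 7680] [1536, 4608, 7168] (n e 997952
  [6144, 6144] [2048, 2048, 10240] e))))) 998144 [3072, 10240] [5120, 9216] (n (n (n (n (n e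
  1006080 [4096, 8192] [4096, 12288] e) 1007616 [4096, 8192] [4096, 12288] (n e 1008800 [4096,
  448, 7168] [1152, 3264, 10432] e)) 1009760 [2560, 2048, 7168] [6144, 8704] (n (n e 1010178
  [1536, 3584, 7168] [5120, 9216] e) 1011712 [4096, 8192] [4096, 12288] (n e 1011872 [512, 4608,
  7680] [4608, 10240] e))) 1012224 [2048, 2048, 8192] [4096, 12288] (n (n (n e 1013760 [12288]
  [16384] e) 1013824 [4096, 8192] [6144, 8192] (n e 1013836 [5376, 8192] [7424, 4864] e)) 1013856
  [1536, 2560, 9216] [6144, 7680] (n (n e 1013920 [4096, 9728] [5120, 8704] e) 1014152 [4608,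
  9728] [1024, 5120, 6144] (n e 1014192 [16384] [4096, 8192] e)))) 1014272 [2048, 12288] [4096,
  10240] (n (n (n (n e 1014336 [4096, 10240] [6144, 8192] e) 1014368 [1536, 2048, 11264] [1536,
  4608, 6656] (n e 1014432 [3072, 12288] [2048, 2048, 9216] e)) 1014528 [2048, 12288] [4096,
  10240] (n (n e 1014560 [2048, 13824] [4864, 8448] e) 1022464 [2048, 4096, 5120] [4096, 12288]
  (n e 1023488 [6144, 6144] [4096, 11264] e))) 1027840 [1024, 4608, 7168] [1024, 3584, 9728] (n
  (n (n e 1030912 [2560, 1024, 9728] [5632, 8704] e) 1031936 [4096, 9728] [5120, 8192] (n e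
  1032064 [3072, 11776] [512, 5120, 6656] e)) 1038848 [2560, 1536, 8192] [4608, 10752] (n (n e
  1039872 [4096, 9216] [5120, 9216] e) 1040384 [4096, 8192] [4096, 12288] (n e 1044224 [1536,
  2048, 10496] [1024, 3840, 8960] e)))))) 1044480 [4096, 8192] [4096, 12288] (n (n (n (n (n (n (n
  e 1044992 [1536, 2560, 8704] [4096, 11776] e) 1046528 [4096, 8192] [4096, 12288] e) 1047040
  [2048, 1024, 10240] [4608, 10240] (n e 1047296 [1536, 1536, 11520] [1280, 3072, 9472] e))
  1047552 [16384] [4096, 12288] (n (n e 1047984 [1552, 15536] [4096, 6384] e) 1048064 [3072,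
  11264] [4096, 10240] (n e 1048320 [2560, 12800] [1024, 3072, 9216] e))) 1048448 [1536, 14848]
  [1536, 2560, 8448] (n (n (n e 1048576 [8192] [16384] e) 1118720 [4096, 4096] [18432] (n e
  1151488 [4096, 4096] [18432] e)) 1152672 [4096, 1792, 4096] [1280, 2816, 11264] (n (n e 1159392
  [1024, 6656, 2560] [4608, 10752] e) 1159504 [4096, 2048, 4096] [2048, 2048, 11264] (n e 1159936
  [6144, 4096] [4096, 12288] e)))) 1167872 [5120, 4096] [4096, 13312] (n (n (n (n e 1223424
  [4096, 6144] [4096, 12288] e) 1225344 [2048, 4096, 4096] [3072, 13312] (n e 1237152 [5120,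
  5120] [5120, 11264] e)) 1237508 [3072, 3072, 3584] [3584, 12800] (n (n e 1256192 [3072, 2048,
  5120] [2048, 14336] e) 1269760 [8192] [4096, 12288] (n e 1269920 [4096, 6144] [4096, 12288]
  e))) 1270272 [6144, 4096] [2048, 14336] (n (n (n e 1270276 [7168, 3072] [2048, 14336] e)
  1288960 [3584, 1536, 5632] [2560, 13312] (n e 1289984 [2560, 2816, 6400] [2304, 768, 11776] e))
  1290144 [1280, 4608, 7424] [4096, 256, 7936] (n (n e 1293192 [3072, 512, 10240] [3072, 3072,
  5632] e) 1302528 [10240] [4096, 14336] (n e 1302688 [4096, 7168] [5120, 10240] e))))) 1303040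
  [7168, 3072] [3072, 14336] (n (n (n (n (n e 1303044 [1408, 6016, 2944] [3456, 12544] e) 1303712
  [1792, 512, 1792, 7680] [5632, 9216] (n e 1303984 [4096, 10240] [8192, 4096] e)) 1304224 [1920,
  640, 1536, 8352] [2528, 2240, 8992] (n (n e 1304944 [1792, 2816, 8960] [1024, 6144, 4864] e)
  1305344 [2560, 2560, 6912] [512, 3840, 10752] (n e 1307136 [1024, 5120, 5120] [3072, 13312]
  e))) 1307296 [3008, 1472, 8512] [2624, 1664, 9600] (n (n (n e 1327104 [8192] [20480] e) 1397248
  [4096, 6144] [4096, 12288] (n e 1401088 [2048, 3072, 5120] [2048, 15360] e)) 1423232 [2560,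
  2304, 7680] [2304, 2304, 9216] (n (n e 1429280 [6912, 5632] [2560, 1536, 9472] e) 1430016
  [4096, 6144] [4096, 12288] (n e 1431200 [3072, 512, 9216] [6656, 6656] e)))) 1433856 [2048,
  3072, 5120] [3072, 14336] (n (n (n (n e 1435040 [3072, 1536, 8192] [2560, 2560, 8192] e)
  1437920 [1024, 4608, 7168] [1024, 5120, 7168] (n e 1438276 [2304, 2560, 7936] [1536, 4352,
  7680] e)) 1438464 [6144, 7168] [2048, 1024, 12288] (n (n e 1454272 [6144, 5120] [2048, 14336]
  e) 1458176 [8192] [20480] (n e 1462352 [5120, 5120] [2048, 1024, 13312] e))) 1462784 [4096,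
  8192] [4096, 12288] (n (n (n e 1462785 [4096, 6144] [4096, 12288] e) 1489792 [4096, 9216]
  [5120, 8192] (n e 1497600 [4096, 7168] [4096, 12288] e)) 1497760 [1408, 3968, 7552] [1152,
  3840, 8832] (n (n e 1497872 [3072, 512, 9728] [512, 5632, 7680] e) 1501952 [3584, 9216] [5120,
  10240] (n e 1503360 [2048, 3072, 7168] [1024, 2048, 13312] e)))))))) 1503632 [2816, 1280, 8960]
  [2816, 1280, 9728] (n (n (n (n (n (n (n (n (n e 1503872 [1280, 3584, 7680] [1792, 1280, 12032]
  e) 1511168 [2048, 4096, 5120] [1024, 3072, 11264] e) 1514048 [1024, 5120, 5120] [1536, 14336]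
  (n e 1522496 [5376, 7936] [5376, 8448] e)) 1522560 [2048, 12288] [6144, 6144] (n (n e 1523712
  [4096, 6144] [18432] e) 1524896 [3072, 3072, 4608] [5120, 10752] (n e 1525856 [3072, 2816,
  4992] [1152, 1792, 12928] e))) 1526024 [3072, 2048, 6144] [1024, 3072, 11264] (n (n (n e
  1527552 [2048, 2048, 8192] [6144, 8192] e) 1528320 [2048, 2048, 8192] [4096, 12288] (n e
  1530368 [4096, 8192] [4096, 12288] e)) 1530432 [1536, 3584, 7168] [1536, 2560, 10752] (n (n e
  1530464 [2560, 2048, 8704] [1536, 3840, 8448] e) 1530528 [1024, 2560, 10752] [2048, 2560, 9216]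
  (n e 1534720 [3072, 10240] [1024, 3072, 11264] e)))) 1536392 [1536, 3584, 8192] [2560, 2048,
  8704] (n (n (n (n e 1536768 [3072, 11264] [4096, 11264] e) 1536769 [5120, 8448] [1280, 3328,
  8960] (n e 1543936 [6144, 6144] [4096, 11264] e)) 1554304 [1024, 3584, 9472] [1280, 4096, 7936]
  (n (n e 1555328 [3072, 11264] [6144, 7168] e) 1556352 [3648, 11392] [6016, 6720] (n e 1556416
  [1536, 14336] [5632, 6656] e))) 1556480 [4096, 6144] [18432] (n (n (n e 1560320 [5120, 8192]
  [5120, 9216] e) 1561088 [4096, 7168] [4096, 12288] (n e 1562272 [2304, 1280, 10240] [1024,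
  4864, 7168] e)) 1563136 [2560, 1024, 9216] [4096, 11776] (n (n e 1563296 [2048, 1664, 10496]
  [1792, 3328, 8192] e) 1564160 [4096, 10240] [1024, 3072, 10240] (n e 1567488 [2304, 1536, 9472]
  [1280, 3072, 10240] e))))) 1568512 [1280, 2560, 10496] [1408, 3072, 9472] (n (n (n (n (n (n e
  1569536 [4608, 9216] [4096, 10752] e) 1571584 [896, 2816, 11008] [1664, 2432, 9856] e) 1571712
  [3072, 12800] [1536, 3072, 8448] (n e 1572864 [8192] [16384] e)) 1589248 [8192] [16384] (n (n e
  1589260 [4096, 4096] [18432] e) 1589280 [4096, 4096] [16384] (n e 1624096 [4096, 6144] [2048,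
  15360] e))) 1624368 [1536, 1024, 3072, 5120] [512, 1536, 1024, 12288] (n (n (n e 1624608 [3072,
  2048, 5120] [2048, 14336] e) 1630724 [3072, 1024, 7168] [3072, 13312] (n e 1643008 [4096, 4096]
  [18432] e)) 1654816 [2048, 2048, 6144] [18432] (n (n e 1657128 [2048, 4096, 4864] [768, 2816,
  11776] e) 1659392 [4096, 6144] [2048, 16384] (n e 1659404 [3072, 3072, 5120] [2048, 2048,
  11264] e)))) 1659424 [4096, 8192] [4096, 12288] (n (n (n (n e 1675040 [7872, 3488] [1248, 2176,
  11168] e) 1675776 [4096, 6144] [4096, 14336] (n e 1677072 [3584, 2048, 5632] [1024, 4608, 8704]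
  e)) 1684224 [6144, 6144] [6144, 8192] (n (n e 1684225 [7168, 4096] [6144, 8192] e) 1687584
  [2048, 2048, 6144] [18432] (n e 1688880 [2944, 2688, 6016] [2816, 640, 11008] e))) 1691928
  [7168, 4608] [512, 4096, 9728] (n (n (n e 1692160 [4096, 7168] [2048, 15360] e) 1692172 [2048,
  3072, 7168] [3072, 11264] (n e 1692192 [6144, 6144] [2048, 2048, 10240] e)) 1692193 [1536,
  5120, 5120] [2048, 2048, 10240] (n (n e 1693344 [3296, 1232, 8400] [1776, 3328, 8784] e)
  1693356 [3072, 11392] [2944, 4096, 3712] (n e 1694240 [2048, 3072, 7168] [2048, 2048, 10240]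
  e)))))) 1694512 [1280, 3328, 9472] [3072, 2048, 7424] (n (n (n (n (n (n (n e 1698592 [1344,
  4416, 7552] [2944, 512, 10624] e) 1699840 [4096, 8192] [4096, 12288] e) 1700000 [1296, 5160,
  5528] [808, 3040, 11256] (n e 1700112 [3072, 1536, 7680] [1024, 4096, 9728] e)) 1700352 [2048,
  3072, 7168] [4096, 12288] (n (n e 1700608 [5120, 8192] [4096, 11264] e) 1700624 [2432, 1664,
  9216] [6016, 8064] (n e 1700628 [1536, 2048, 10496] [7168, 5376] e))) 1724944 [5120, 6144]
  [3072, 13312] (n (n (n e 1728512 [4096, 6144] [18432] e) 1729024 [4096, 8192] [18432] (n e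
  1747712 [3072, 2048, 6144] [5120, 10240] e)) 1755680 [4096, 7168] [2048, 2048, 11264] (n (n e
  1757712 [1536, 3584, 6656] [3072, 12800] e) 1759856 [1536, 3328, 8960] [2048, 4096, 6144] (n e
  1761796 [2560, 3072, 5632] [4096, 11776] e)))) 1764096 [2048, 2048, 9216] [2048, 2048, 11264]
  (n (n (n (n e 1764108 [2048, 2048, 9728] [3072, 2560, 6656] e) 1764128 [2816, 512, 10496]
  [1280, 3584, 9216] (n e 1780480 [2560, 1536, 7680] [4096, 11776] e)) 1788448 [1024, 4096, 7168]
  [4096, 11264] (n (n e 1792520 [5632, 7168] [4096, 10752] e) 1794048 [4096, 6144] [18432] (n e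
  1794560 [4096, 8192] [2048, 14336] e))) 1794564 [6656, 5120] [3072, 12800] (n (n (n e 1795744
  [3584, 9728] [2048, 3072, 8704] e) 1796192 [4096, 8192] [3072, 1024, 10240] (n e 1796360 [2304,
  2688, 7424] [1408, 2304, 11264] e)) 1796864 [2560, 10752] [2048, 13312] (n (n e 1796872 [2560,
  1984, 8896] [1088, 1408, 640, 10880] e) 1796876 [5312, 9024] [3136, 960, 8448] (n e 1796896
  [4096, 10240] [2048, 2048, 10240] e))))) 1798656 [1024, 3072, 9216] [3072, 13312] (n (n (n (n
  (n e 1798928 [1024, 2048, 11264] [4608, 9728] e) 1813248 [3072, 1024, 7936] [4096, 11520] (n e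
  1817480 [3584, 11776] [1536, 5120, 5120] e)) 1821216 [2048, 3072, 7168] [1024, 3072, 11264] (n
  (n e 1822240 [1024, 4096, 8192] [1280, 3072, 9984] e) 1825392 [1184, 2464, 11168] [1120, 5760,
  4896] (n e 1826816 [4096, 8192] [2048, 14336] e))) 1827328 [5120, 7168] [3072, 13312] (n (n (n
  e 1828000 [2304, 2048, 8960] [1536, 3072, 9728] e) 1829632 [2560, 1024, 10240] [2304, 768,
  11776] (n e 1831424 [1024, 3584, 8192] [3072, 12800] e)) 1833472 [1024, 3072, 9728] [1536,
  1536, 12288] (n (n e 1835008 [8192] [16384] e) 1836192 [4096, 4096] [4096, 12288] (n e 1836548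
  [4096, 5120] [2048, 15360] e)))) 1839616 [4096, 6144] [18432] (n (n (n (n e 1851392 [4096,
  8192] [20480] e) 1859584 [12288] [16384] (n e 1859588 [4096, 8192] [2048, 14336] e)) 1860096
  [12288] [16384] (n (n e 1860100 [4096, 8192] [16896] e) 1874432 [2048, 4096, 4096] [4096,
  12288] (n e 1874592 [2560, 1024, 8192] [2048, 3072, 9728] e))) 1878272 [3072, 2048, 5120]
  [3072, 13312] (n (n (n e 1878784 [2560, 1536, 7680] [4096, 11776] e) 1878788 [1024, 1536, 2048,
  7424] [2304, 1280, 11008] (n e 1892356 [2048, 2048, 7168] [2048, 14336] e)) 1893540 [2532,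
  2550, 7766] [2530, 1832, 9210] (n (n e 1894052 [5312, 9024] [3136, 960, 8448] e) 1894500 [1024,
  4864, 6912] [2048, 2560, 8704] (n e 1894656 [4096, 8192] [2048, 1024, 13312] e))))))) 1894688
  [3072, 10240] [2048, 2048, 10240] (n (n (n (n (n (n (n (n e 1894689 [5120, 8192] [4096, 9216]
  e) 1895168 [2560, 10752] [2048, 13312] e) 1895172 [1280, 3328, 8960] [2048, 2048, 9728] (n e
  1895200 [2560, 704, 10880] [2496, 896, 11008] e)) 1895204 [1024, 3072, 10496] [2240, 2560,
  8064] (n (n e 1896608 [2560, 2048, 8192] [2048, 1536, 11264] e) 1896964 [1680, 3040, 8288]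
  [1264, 1776, 12144] (n e 1905152 [4096, 6144] [2048, 16384] e))) 1906336 [2304, 3328, 6400]
  [1280, 3840, 9472] (n (n (n e 1907296 [2560, 3072, 6144] [2048, 2048, 10240] e) 1910532 [2048,
  3072, 7168] [1024, 3584, 9728] (n e 1911554 [1920, 3712, 6656] [1920, 1536, 11264] e)) 1913600
  [4096, 8192] [4096, 12288] (n (n e 1913601 [2048, 3072, 7168] [2048, 3072, 9216] e) 1921536
  [2048, 2048, 8192] [3072, 14336] (n e 1927456 [4096, 9216] [5120, 10240] e)))) 1927972 [1280,
  512, 13568] [5632, 7424] (n (n (n (n e 1929216 [4096, 8192] [2048, 14336] e) 1929376 [5120,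
  8192] [2048, 13312] (n e 1929728 [1024, 2048, 10240] [2048, 14336] e)) 1929732 [4096, 9216]
  [4096, 10240] (n (n e 1929984 [3072, 11264] [3072, 12288] e) 1930016 [3088, 12032] [3488,
  11248] (n e 1937920 [4096, 7168] [3072, 14336] e))) 1943300 [2112, 3200, 7616] [2112, 2304,
  9600] (n (n (n e 1946368 [4096, 9216] [4096, 11264] e) 1946369 [576, 5248, 7040] [576, 4480,
  8896] (n e 1948416 [3328, 10240] [1024, 3840, 9728] e)) 1948576 [896, 2624, 11968] [2688, 2432,
  7104] (n (n e 1954304 [2048, 2048, 8192] [3072, 13312] e) 1960224 [1536, 2560, 9728] [512,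
  4608, 9216] (n e 1961248 [4096, 10496] [5376, 8448] e))))) 1961984 [4096, 8192] [2048, 14336]
  (n (n (n (n (n e 1962144 [1536, 3776, 8064] [2240, 1280, 11008] e) 1962496 [1280, 2304, 9728]
  [2816, 13312] (n e 1962752 [4096, 10112] [3584, 11392] e)) 1966080 [8192] [16384] (n (n e
  1967264 [4096, 6144] [3072, 13312] e) 1969920 [6144, 5120] [4096, 11264] (n e 1970688 [4096,
  8192] [18432] e))) 1971796 [4096, 8192] [4096, 8704] (n (n (n e 1971840 [1536, 4608, 5120]
  [1536, 1024, 13312] e) 1971872 [2048, 3072, 7680] [2560, 512, 11776] (n e 1972736 [1024, 4096,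
  6144] [2048, 15360] e)) 1972896 [3072, 10240] [2048, 2048, 10240] (n (n e 1977088 [6144, 6144]
  [2048, 14336] e) 1978496 [5120, 6144] [17408] (n e 1979136 [16384] [4096, 12288] e)))) 1979137
  [4096, 9216] [4096, 10240] (n (n (n (n e 1982464 [2048, 8192] [18432] e) 1983648 [2560, 3072,
  5632] [2048, 13824] (n e 1983760 [3072, 1536, 7168] [1536, 2048, 12288] e)) 1987072 [4096,
  8192] [2048, 14336] (n (n e 1987073 [2560, 1536, 7936] [1280, 1024, 13568] e) 1990656 [2048,
  10240] [18432] (n e 1991168 [2048, 11264] [17408] e))) 1991172 [4608, 8192] [2560, 13312] (n (n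
  (n e 1994752 [12288] [16384] e) 1994753 [4096, 8192] [2048, 14336] (n e 1994832 [2560, 1536,
  8704] [4864, 10240] e)) 1994836 [1024, 3840, 8448] [5888, 7680] (n (n e 1994880 [4096, 10240]
  [4096, 12288] e) 1994912 [4096, 9728] [3584, 11776] (n e 1995264 [2048, 12288] [2048, 14336]
  e)))))) 1995520 [15360] [2048, 13312] (n (n (n (n (n (n (n e 2005504 [1536, 3584, 6656] [3072,
  13312] e) 2005664 [1280, 1280, 768, 9856] [2432, 1792, 9984] e) 2009856 [1536, 3072, 8192]
  [1536, 1536, 12288] (n e 2011264 [2048, 3072, 7168] [1024, 2048, 13312] e)) 2013952 [1536,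
  2048, 10752] [1536, 2560, 10240] (n (n e 2013953 [1024, 3840, 9216] [2560, 2560, 7680] e)
  2014080 [3072, 12288] [1024, 4096, 8192] (n e 2021888 [2048, 2048, 8704] [3584, 12288] e)))
  2022048 [1280, 2816, 10496] [3072, 1024, 9216] (n (n (n e 2026240 [1408, 2048, 10752] [1024,
  2432, 11392] e) 2027604 [5376, 8704] [1792, 3584, 7424] (n e 2027648 [2048, 2048, 9216] [1024,
  3072, 11264] e)) 2029568 [3072, 10240] [2048, 14336] (n (n e 2030080 [1856, 704, 11712] [960,
  1536, 12928] e) 2031616 [12288] [20480] (n e 2032800 [4096, 7104] [3008, 13504] e)))) 2035456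
  [768, 5120, 6400] [1280, 1536, 12544] (n (n (n (n e 2036224 [1024, 3072, 7168] [17408] e)
  2038272 [5120, 7168] [1024, 15360] (n e 2038432 [2560, 11776] [1024, 1280, 12032] e)) 2039288
  [1472, 15232] [1216, 6976, 640] (n (n e 2039296 [768, 4864, 6912] [768, 1792, 13312] e) 2042624
  [512, 3584, 9216] [1024, 1536, 12800] (n e 2043648 [896, 4224, 8320] [1920, 1152, 11520] e)))
  2044672 [2048, 12288] [4096, 10240] (n (n (n e 2044673 [4608, 9216] [2560, 11264] e) 2045824
  [4352, 10240] [2304, 1792, 9472] (n e 2046016 [5120, 8192] [1024, 2048, 12288] e)) 2046344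
  [4864, 9728] [2048, 2816, 7936] (n (n e 2046528 [5120, 8704] [2560, 11776] e) 2046720 [3072,
  12288] [1024, 3072, 10240] (n e 2046848 [16384] [5120, 8192] e))))) 2046856 [3456, 12160]
  [1152, 5120, 5760] (n (n (n (n (n e 2046880 [1488, 15176] [808, 3968, 7800] e) 2048000 [4096,
  8192] [18432] (n e 2050312 [2560, 2048, 7936] [2304, 13056] e)) 2051840 [1024, 3328, 9472]
  [1024, 3328, 10240] (n (n e 2052608 [2048, 1024, 10240] [1024, 1024, 14336] e) 2054656 [4096,
  10240] [1024, 2048, 12288] (n e 2054816 [3072, 12544] [1280, 2816, 9472] e))) 2056192 [4096,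
  8192] [2048, 14336] (n (n (n e 2056704 [3072, 10240] [1024, 15360] e) 2058336 [2176, 2176,
  9344] [1920, 2304, 10112] (n e 2059008 [768, 1792, 12288] [1792, 13056] e)) 2060288 [2048,
  12288] [2048, 14336] (n (n e 2060800 [2048, 12288] [1024, 1024, 13824] e) 2061056 [2048, 13312]
  [1024, 1024, 12800] (n e 2062336 [14336] [16384] e)))) 2062400 [3584, 10752] [4096, 10752] (n
  (n (n (n e 2062848 [2304, 12800] [2816, 12544] e) 2063104 [1664, 14336] [1152, 1664, 11392] (n
  e 2064384 [12288] [20480] e)) 2068992 [1536, 2560, 7680] [17664] (n (n e 2077440 [3072, 11264]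
  [4096, 11264] e) 2079488 [1410, 1352, 11970] [4434, 10042] (n e 2079616 [1536, 14336] [5120,
  8192] e))) 2080768 [4096, 8192] [18432] (n (n (n e 2085376 [2560, 10496] [2304, 14336] e)
  2087424 [1408, 1792, 10752] [3072, 12672] (n e 2088960 [3072, 9216] [17408] e)) 2089472 [3552,
  9856] [17024] (n (n e 2093056 [3072, 10240] [2048, 14336] e) 2095104 [2048, 12288] [1024,
  15360] (n e 2096128 [15360] [16384] e))))))))

end Tree

/-! ### Correctness of the enumeration -/

lemma bit_eq_testBit (c k : ℕ) : bit c k = c.testBit k := by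
  rw [Nat.testBit_eq_decide_div_mod_eq]
  exact Bool.eq_iff_iff.2 (by simp [bit]; rfl)

lemma adj_of_lt {c i j : ℕ} (h : i < j) : adj c i j = c.testBit (pairIndex i j) := by
  have : Nat.blt i j = true := by simpa [Nat.blt_eq] using h
  simp only [adj, this, bit_eq_testBit]

lemma adj_self (c i : ℕ) : adj c i i = false := by
  have : Nat.blt i i = false := by
    rw [Bool.eq_false_iff, Ne, Nat.blt_eq]
    omega
  simp only [adj, this]

lemma adj_of_gt {c i j : ℕ} (h : j < i) : adj c i j = c.testBit (pairIndex j i) := by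
  have h₁ : Nat.blt j i = true := by simpa [Nat.blt_eq] using h
  have h₂ : Nat.blt i j = false := by
    rw [Bool.eq_false_iff, Ne, Nat.blt_eq]
    omega
  simp only [adj, h₁, h₂, bit_eq_testBit]

lemma adj_comm (c i j : ℕ) : adj c i j = adj c j i := by
  rcases lt_trichotomy i j with h | rfl | h
  · rw [adj_of_lt h, adj_of_gt h]
  · rfl
  · rw [adj_of_lt h, adj_of_gt h]

/-- The graph on `Fin n` coded by `c`. -/
def graph (n c : ℕ) : SimpleGraph (Fin n) where
  Adj i j := adj c i j = true
  symm := ⟨fun i j h => by rwa [adj_comm]⟩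
  loopless := ⟨fun i h => by simp [adj_self] at h⟩

@[simp] lemma graph_adj {n c : ℕ} {i j : Fin n} : (graph n c).Adj i j ↔ adj c i j = true := Iff.rfl

lemma allBelow_iff {p : ℕ → Bool} {n : ℕ} : allBelow p n = true ↔ ∀ i < n, p i = true := by
  induction n with
  | zero => simp [allBelow]
  | succ n ih =>
    have : allBelow p (n + 1) = (p n && allBelow p n) := by
      change @Bool.rec (fun _ => Bool) false (allBelow p n) (p n) = _
      cases p n <;> rfl
    rw [this, Bool.and_eq_true, ih, Nat.forall_lt_succ_right, and_comm]

lemma exists_iso_of_isoCheck {n c d s : ℕ} (h : isoCheck n c d s = true) :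
    Nonempty (graph n c ≃g graph n d) := by
  simp only [isoCheck, allBelow_iff, Bool.and_eq_true, Nat.blt_eq] at h
  have key : ∀ j < n, ∀ i < j, digit s i ≠ digit s j ∧
      adj c i j = adj d (digit s i) (digit s j) := by
    intro j hj i hi
    have := (h j hj).2 i hi
    cases hb : Nat.beq (digit s i) (digit s j)
    · refine ⟨Nat.ne_of_beq_eq_false hb, ?_⟩
      rw [hb] at this
      revert this
      cases adj c i j <;> cases adj d (digit s i) (digit s j) <;> simp
    · rw [hb] at this
      simp at this
  let f : Fin n → Fin n := fun i => ⟨digit s i, (h i i.2).1⟩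
  have hf : Function.Injective f := by
    intro i j hij
    have hij' : digit s i = digit s j := congrArg Fin.val hij
    rcases lt_trichotomy i j with hlt | heq | hlt
    · exact absurd hij' (key j j.2 i hlt).1
    · exact heq
    · exact absurd hij'.symm (key i i.2 j hlt).1
  refine ⟨⟨Equiv.ofBijective f (Finite.injective_iff_bijective.1 hf), ?_⟩⟩
  intro i j
  change adj d (digit s i) (digit s j) = true ↔ adj c i j = true
  rcases lt_trichotomy i j with hlt | rfl | hlt
  · rw [(key j j.2 i hlt).2]
  · simp [adj_self]
  · rw [adj_comm d, adj_comm c, (key i i.2 j hlt).2]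

lemma pairIndex_lt {i j n : ℕ} (hi : i < j) (hj : j < n) : pairIndex i j < pairIndex 0 n := by
  change j * (j - 1) / 2 + i < n * (n - 1) / 2 + 0
  have h1 : j * (j - 1) / 2 + j = (j + 1) * (j + 1 - 1) / 2 := by
    obtain ⟨k, rfl⟩ : ∃ k, j = k + 1 := ⟨j - 1, by omega⟩
    have : (k + 1 + 1) * (k + 1 + 1 - 1) = (k + 1) * (k + 1 - 1) + 2 * (k + 1) := by
      simp only [Nat.add_sub_cancel]; ring
    rw [this]
    omega
  have h2 : (j + 1) * (j + 1 - 1) / 2 ≤ n * (n - 1) / 2 :=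
    Nat.div_le_div_right (Nat.mul_le_mul hj (Nat.sub_le_sub_right hj 1))
  omega

lemma graph_xor_fullCode (n c : ℕ) : graph n (c ^^^ fullCode n) = (graph n c)ᶜ := by
  ext i j
  rw [SimpleGraph.compl_adj]
  simp only [graph_adj]
  have key : ∀ i j : ℕ, i < j → j < n → adj (c ^^^ fullCode n) i j = !adj c i j := by
    intro i j hij hj
    rw [adj_of_lt hij, adj_of_lt hij, Nat.testBit_xor, fullCode, Nat.testBit_two_pow_sub_one]
    simp [pairIndex_lt hij hj]
  rcases lt_trichotomy i j with hlt | rfl | hlt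
  · simp [key i j hlt j.2, hlt.ne]
  · simp [adj_self]
  · rw [adj_comm, adj_comm c]
    simp [key j i hlt i.2, hlt.ne']

/-- A graph is a coded one-vertex extension of a vertex-deleted subgraph. -/
lemma exists_iso_extension {n h : ℕ} (hh : h < 2 ^ pairIndex 0 n) (G : SimpleGraph (Fin (n + 1)))
    (v : Fin (n + 1)) (e : G.comap v.succAbove ≃g graph n h) :
    ∃ S < 2 ^ n, (∀ i : Fin n, S.testBit i = true ↔ G.Adj v (v.succAbove (e.symm i))) ∧
      Nonempty (G ≃g graph (n + 1) (h ||| S <<< pairIndex 0 n)) := by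
  classical
  let f : Fin n → Bool := fun i => decide (G.Adj v (v.succAbove (e.symm i)))
  have hf : ∀ i : Fin n, (Nat.ofBits f).testBit i = f i := fun i => by
    rw [Nat.testBit_ofBits_lt _ _ i.2]
  refine ⟨Nat.ofBits f, Nat.ofBits_lt_two_pow f, fun i => by rw [hf]; simp [f], ?_⟩
  set S := Nat.ofBits f
  set c := h ||| S <<< pairIndex 0 n
  have hold : ∀ i j : Fin n, adj c i j = adj h i j := by
    have key : ∀ i j : Fin n, i < j → adj c i j = adj h i j := by
      intro i j hij
      have h1 := pairIndex_lt hij j.2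
      rw [adj_of_lt hij, adj_of_lt hij, Nat.testBit_or, Nat.testBit_shiftLeft]
      simp [h1]
    intro i j
    rcases lt_trichotomy i j with hlt | rfl | hlt
    · exact key i j hlt
    · simp [adj_self]
    · rw [adj_comm, adj_comm h, key j i hlt]
  have hnew : ∀ i : Fin n, adj c i n = f i := by
    intro i
    have h1 : pairIndex i n = pairIndex 0 n + i := rfl
    rw [adj_of_lt i.2, Nat.testBit_or, Nat.testBit_shiftLeft, h1,
      Nat.testBit_lt_two_pow (hh.trans_le (Nat.pow_le_pow_right two_pos (Nat.le_add_right _ _)))]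
    simp [hf]
  let σ : Fin (n + 1) ≃ Fin (n + 1) :=
    (finSuccEquiv' v).trans ((Equiv.optionCongr e.toEquiv).trans (finSuccEquiv' (Fin.last n)).symm)
  have hσv : σ v = Fin.last n := by simp [σ]
  have hσ : ∀ i, σ (v.succAbove i) = (e i).castSucc := by intro i; simp [σ]
  refine ⟨⟨σ, ?_⟩⟩
  intro a b
  induction a using Fin.succAboveCases v with
  | x =>
    induction b using Fin.succAboveCases v with
    | x => simp
    | p j =>
      rw [hσv, hσ, SimpleGraph.adj_comm, graph_adj]
      simp only [Fin.val_castSucc, Fin.val_last]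
      rw [hnew]
      simp [f]
  | p i =>
    induction b using Fin.succAboveCases v with
    | x =>
      rw [hσv, hσ, graph_adj]
      simp only [Fin.val_castSucc, Fin.val_last]
      rw [hnew]
      simp [f, SimpleGraph.adj_comm]
    | p j =>
      rw [hσ, hσ, graph_adj]
      simp only [Fin.val_castSucc]
      rw [hold, ← graph_adj, e.map_adj_iff]
      rfl

lemma exists_of_zipAll {f : ℕ → ℕ → Bool} {l m : List ℕ} (h : zipAll f l m = true) {x : ℕ}
    (hx : x ∈ l) : ∃ y, f x y = true := by
  induction l generalizing m with
  | nil => simp at hx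
  | cons a l ih =>
    cases m with
    | nil => simp [zipAll] at h
    | cons b m =>
      simp only [zipAll, Bool.and_eq_true] at h
      rcases List.mem_cons.1 hx with rfl | hx
      · exact ⟨b, h.1⟩
      · exact ih h.2 hx

/-- Extending representatives of the graphs on `n` vertices. -/
lemma exists_iso_of_extensionCheck {n : ℕ} {nbhds : List ℕ} {mem : ℕ → Bool}
    {data : List (ℕ × List ℕ)} (hcheck : extensionCheck n nbhds mem data = true)
    (G : SimpleGraph (Fin (n + 1))) (v : Fin (n + 1))
    (hG : ∃ h, memKeys data h = true ∧ Nonempty (G.comap v.succAbove ≃g graph n h))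
    (hv : ∀ S < 2 ^ n, ∀ σ : Fin n ≃ Fin n,
      (∀ i : Fin n, S.testBit i = true ↔ G.Adj v (v.succAbove (σ i))) → S ∈ nbhds) :
    ∃ d, mem d = true ∧ Nonempty (G ≃g graph (n + 1) d) := by
  obtain ⟨h, hh, ⟨e⟩⟩ := hG
  obtain ⟨p, hp, hph⟩ := List.any_eq_true.1 hh
  obtain rfl := Nat.eq_of_beq_eq_true hph
  have hp' := List.all_eq_true.1 hcheck p hp
  rw [Bool.and_eq_true, Nat.blt_eq] at hp'
  obtain ⟨S, hS, hS', ⟨e'⟩⟩ := exists_iso_extension hp'.1 G v e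
  obtain ⟨s, hs⟩ := exists_of_zipAll hp'.2 (hv S hS e.symm.toEquiv hS')
  rw [Bool.and_eq_true] at hs
  obtain ⟨e''⟩ := exists_iso_of_isoCheck hs.1
  exact ⟨_, hs.2, ⟨e'.trans e''⟩⟩

lemma exists_iso_of_extensionCheck_range {n : ℕ} {data data' : List (ℕ × List ℕ)}
    (hcheck : extensionCheck n (List.range (2 ^ n)) (memKeys data') data = true)
    (hn : ∀ G : SimpleGraph (Fin n), ∃ h, memKeys data h = true ∧ Nonempty (G ≃g graph n h))
    (G : SimpleGraph (Fin (n + 1))) :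
    ∃ d, memKeys data' d = true ∧ Nonempty (G ≃g graph (n + 1) d) :=
  exists_iso_of_extensionCheck hcheck G 0 (hn _) fun _ hS _ _ => List.mem_range.2 hS

lemma Tree.exists_of_mem_of_all {p : ℕ → List ℕ → List ℕ → Bool} {c : ℕ} {t : Tree}
    (ht : t.all p = true) (hc : t.mem c = true) : ∃ us ls, p c us ls = true := by
  induction t with
  | e => simp [Tree.mem] at hc
  | n l x u v r ihl ihr =>
    simp only [Tree.all, Bool.and_eq_true] at ht
    simp only [Tree.mem] at hc
    cases h₁ : Nat.beq c x
    · cases h₂ : Nat.blt c x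
      · exact ihr ht.2.2 (by simpa [h₁, h₂] using hc)
      · exact ihl ht.2.1 (by simpa [h₁, h₂] using hc)
    · obtain rfl := Nat.eq_of_beq_eq_true h₁
      exact ⟨u, v, ht.1⟩

/-- The exceptional graph and the graphs with energy less than that of the complement. -/
def memPairs (c : ℕ) : Bool := Nat.beq c 1927968 || Tree.energyPairs.mem c

lemma extensionCheck_energyPairs :
    extensionCheck 6 smallSets (fun c => memPairs c || memPairs (c ^^^ fullCode 7))
      extensionData6 = true := by
  decide +kernel

lemma all_energyPairs : Tree.energyPairs.all energyCheck = true := by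
  decide +kernel

lemma exists_iso_six (G : SimpleGraph (Fin 6)) :
    ∃ c, memKeys extensionData6 c = true ∧ Nonempty (G ≃g graph 6 c) := by
  have h₀ : ∀ G : SimpleGraph (Fin 0), ∃ c, memKeys extensionData0 c = true ∧
      Nonempty (G ≃g graph 0 c) := fun G =>
    ⟨0, by decide +kernel, ⟨Equiv.refl _, fun {a} => a.elim0⟩⟩
  have h₁ := exists_iso_of_extensionCheck_range (data' := extensionData1) (by decide +kernel) h₀
  have h₂ := exists_iso_of_extensionCheck_range (data' := extensionData2) (by decide +kernel) h₁
  have h₃ := exists_iso_of_extensionCheck_range (data' := extensionData3) (by decide +kernel) h₂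
  have h₄ := exists_iso_of_extensionCheck_range (data' := extensionData4) (by decide +kernel) h₃
  have h₅ := exists_iso_of_extensionCheck_range (data' := extensionData5) (by decide +kernel) h₄
  exact exists_iso_of_extensionCheck_range (data' := extensionData6) (by decide +kernel) h₅ G

lemma mem_smallSets {S : ℕ} (hS : S < 64)
    (h : (Finset.univ.filter fun i : Fin 6 => S.testBit i = true).card ≤ 2) : S ∈ smallSets := by
  have : ∀ S : Fin 64, (Finset.univ.filter fun i : Fin 6 => (S : ℕ).testBit i = true).card ≤ 2 →
      (S : ℕ) ∈ smallSets := by decide +kernel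
  exact this ⟨S, hS⟩ h

/-- In a pair of complementary graphs of order seven, some vertex has degree at most two. -/
lemma exists_degree_le_two (G : SimpleGraph (Fin 7)) [DecidableRel G.Adj] :
    (∃ v, G.degree v ≤ 2) ∨ ∃ v, Gᶜ.degree v ≤ 2 := by
  by_contra! h
  have h3 : ∀ v, G.degree v = 3 := fun v => by
    have h₁ := h.1 v
    have h₂ := h.2 v
    rw [SimpleGraph.degree_compl, Fintype.card_fin] at h₂
    omega
  have := G.sum_degrees_eq_twice_card_edges
  simp only [h3, Finset.sum_const, Finset.card_univ, Fintype.card_fin, smul_eq_mul] at this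
  omega

lemma exists_iso_of_degree_le_two (G : SimpleGraph (Fin 7)) [DecidableRel G.Adj] {v : Fin 7}
    (hv : G.degree v ≤ 2) :
    ∃ c, (memPairs c || memPairs (c ^^^ fullCode 7)) = true ∧ Nonempty (G ≃g graph 7 c) := by
  refine exists_iso_of_extensionCheck extensionCheck_energyPairs G v (exists_iso_six _) ?_
  intro S hS σ h
  refine mem_smallSets hS (le_trans ?_ hv)
  refine Finset.card_le_card_of_injOn (fun i => v.succAbove (σ i)) (fun i hi => ?_)
    fun i _ j _ hij => σ.injective (Fin.succAbove_right_injective hij)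
  simpa [h] using hi

/-- The graph isomorphism induced on complements. -/
lemma nonempty_compl_iso {V W : Type*} {G : SimpleGraph V} {H : SimpleGraph W}
    (h : Nonempty (G ≃g H)) : Nonempty (Gᶜ ≃g Hᶜ) := by
  obtain ⟨e⟩ := h
  refine ⟨e.toEquiv, fun {a b} => ?_⟩
  simpa [SimpleGraph.compl_adj] using fun _ => not_congr e.map_adj_iff

lemma exists_iso_memPairs (G : SimpleGraph (Fin 7)) :
    ∃ c, memPairs c = true ∧ (Nonempty (G ≃g graph 7 c) ∨ Nonempty (Gᶜ ≃g graph 7 c)) := by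
  classical
  have key : ∃ c, (memPairs c || memPairs (c ^^^ fullCode 7)) = true ∧
      (Nonempty (G ≃g graph 7 c) ∨ Nonempty (Gᶜ ≃g graph 7 c)) := by
    rcases exists_degree_le_two G with ⟨v, hv⟩ | ⟨v, hv⟩
    · obtain ⟨c, hc, h⟩ := exists_iso_of_degree_le_two G hv
      exact ⟨c, hc, Or.inl h⟩
    · obtain ⟨c, hc, h⟩ := exists_iso_of_degree_le_two Gᶜ hv
      exact ⟨c, hc, Or.inr h⟩
  obtain ⟨c, hc, h⟩ := key
  rcases Bool.or_eq_true_iff.1 hc with hc | hc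
  · exact ⟨c, hc, h⟩
  · refine ⟨_, hc, ?_⟩
    rw [graph_xor_fullCode]
    rcases h with h | h
    · exact Or.inr (nonempty_compl_iso h)
    · have := nonempty_compl_iso h
      rw [compl_compl] at this
      exact Or.inl this

/-! ### The energy in terms of eigenvalues -/

lemma energy_eq {V : Type*} [Fintype V] [DecidableEq V] (G : SimpleGraph V)
    [DecidableRel G.Adj] :
    energy G = ((G.adjMatrix ℝ).charpoly.roots.map (fun x => |x|)).sum := by
  have h : adjMat G = G.adjMatrix ℝ := by
    ext i j
    simp [adjMat, SimpleGraph.adjMatrix_apply]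
  rw [energy, h]
  congr!

lemma energy_congr {V W : Type*} [Finite V] [Finite W] {G : SimpleGraph V} {H : SimpleGraph W}
    (h : Nonempty (G ≃g H)) : energy G = energy H := by
  classical
  obtain ⟨e⟩ := h
  have := Fintype.ofFinite V
  have := Fintype.ofFinite W
  rw [energy_eq, energy_eq, ← Matrix.charpoly_reindex e.toEquiv]
  congr 4
  ext i j
  simp only [Matrix.reindex_apply, Matrix.submatrix_apply, SimpleGraph.adjMatrix_apply]
  exact if_congr e.symm.map_adj_iff rfl rfl

lemma trace_pow_eq_sum_eigenvalues {n : Type*} [Fintype n] [DecidableEq n] {A : Matrix n n ℝ}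
    (hA : A.IsHermitian) (k : ℕ) : (A ^ k).trace = ∑ i, hA.eigenvalues i ^ k := by
  conv_lhs => rw [hA.spectral_theorem, ← map_pow, Unitary.conjStarAlgAut_apply,
    Matrix.trace_mul_cycle, Unitary.coe_star_mul_self, one_mul, Matrix.diagonal_pow,
    Matrix.trace_diagonal]
  simp

/-- The eigenvalues of a graph, with their power sums. -/
lemma exists_eigenvalues {V : Type*} [Fintype V] [DecidableEq V] (G : SimpleGraph V)
    [DecidableRel G.Adj] : ∃ x : V → ℝ, (∀ k, ∑ i, x i ^ k = (G.adjMatrix ℝ ^ k).trace) ∧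
      energy G = ∑ i, |x i| := by
  have hA : (G.adjMatrix ℝ).IsHermitian := by
    rw [Matrix.IsHermitian, Matrix.conjTranspose_eq_transpose_of_trivial,
      SimpleGraph.transpose_adjMatrix]
  refine ⟨hA.eigenvalues, fun k => (trace_pow_eq_sum_eigenvalues hA k).symm, ?_⟩
  rw [energy_eq, hA.roots_charpoly_eq_eigenvalues, Multiset.map_map]
  rfl

/-- The energy is twice the sum of the positive eigenvalues. -/
lemma sum_abs_eq_two_mul_sum_max {ι : Type*} [Fintype ι] {x : ι → ℝ} (h : ∑ i, x i = 0) :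
    ∑ i, |x i| = 2 * ∑ i, max (x i) 0 := by
  have : ∀ i, |x i| = 2 * max (x i) 0 - x i := fun i => by
    rcases le_total (x i) 0 with hi | hi
    · rw [abs_of_nonpos hi, max_eq_right hi]; ring
    · rw [abs_of_nonneg hi, max_eq_left hi]; ring
  rw [Finset.sum_congr rfl fun i _ => this i, Finset.sum_sub_distrib, h, sub_zero, Finset.mul_sum]

/-! ### Correctness of the power sums -/

/-- The adjacency matrix of the graph on seven vertices coded by `c`. -/
def natMatrix (c : ℕ) : Matrix (Fin 7) (Fin 7) ℕ := fun i j => (adj c i j).toNat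

/-- The rows of a matrix, as numbers in base `2 ^ 20`. -/
def packedRows (N : Matrix (Fin 7) (Fin 7) ℕ) : List ℕ :=
  List.ofFn fun i => ∑ j, N i j * 1048576 ^ (j : ℕ)

lemma selectSum_cons (b : Bool) (bs : List Bool) (r : ℕ) (rs : List ℕ) :
    selectSum (b :: bs) (r :: rs) = b.toNat * r + selectSum bs rs := by
  cases b
  · change selectSum bs rs = _
    simp
  · change r + selectSum bs rs = _
    simp

lemma selectSum_ofFn {n : ℕ} (b : Fin n → Bool) (r : Fin n → ℕ) :
    selectSum (List.ofFn b) (List.ofFn r) = ∑ j, (b j).toNat * r j := by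
  induction n with
  | zero => simp; rfl
  | succ n ih => rw [List.ofFn_succ, List.ofFn_succ, selectSum_cons, ih, Fin.sum_univ_succ]

lemma rows_eq (c : ℕ) :
    rows c = List.ofFn fun i : Fin 7 => List.ofFn fun j : Fin 7 => adj c i j := by
  simp only [List.ofFn_succ, List.ofFn_zero]
  rfl

lemma mulRows_packedRows (c : ℕ) (N : Matrix (Fin 7) (Fin 7) ℕ) :
    mulRows (rows c) (packedRows N) = packedRows (natMatrix c * N) := by
  rw [mulRows, rows_eq, List.map_ofFn, packedRows, packedRows]
  congr 1
  funext i
  rw [Function.comp_apply, selectSum_ofFn]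
  simp only [Matrix.mul_apply, natMatrix, Finset.mul_sum, Finset.sum_mul, mul_assoc]
  exact Finset.sum_comm

lemma sum_mul_pow_div_mod {f : Fin 7 → ℕ} (hf : ∀ j, f j < 1048576) (i : Fin 7) :
    (∑ j, f j * 1048576 ^ (j : ℕ)) / 1048576 ^ (i : ℕ) % 1048576 = f i := by
  have h0 := hf 0
  have h1 := hf 1
  have h2 := hf 2
  have h3 := hf 3
  have h4 := hf 4
  have h5 := hf 5
  have h6 := hf 6
  fin_cases i <;> simp [Fin.sum_univ_seven] <;> omega

lemma traceRows_ofFn {n : ℕ} (r : Fin n → ℕ) :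
    traceRows (List.ofFn r) = ∑ i, r i / 1048576 ^ (i : ℕ) % 1048576 := by
  have key : ∀ {n : ℕ} (r : Fin n → ℕ) (x : ℕ), List.rec (motive := fun _ => ℕ → ℕ) (fun _ => 0)
      (fun r _ ih x => Nat.add (Nat.mod (Nat.div r x) 1048576) (ih (Nat.mul x 1048576)))
      (List.ofFn r) x = ∑ i, r i / (x * 1048576 ^ (i : ℕ)) % 1048576 := by
    intro n
    induction n with
    | zero => simp
    | succ n ih =>
      intro r x
      rw [List.ofFn_succ, Fin.sum_univ_succ]
      rw [Fin.val_zero, pow_zero, mul_one]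
      refine congrArg₂ (· + ·) rfl ((ih _ _).trans (Finset.sum_congr rfl fun i _ => ?_))
      rw [Nat.mul_eq, Fin.val_succ, pow_succ', mul_assoc]
  exact (key r 1).trans (by simp only [one_mul])

lemma traceRows_packedRows {N : Matrix (Fin 7) (Fin 7) ℕ} (hN : ∀ i j, N i j < 1048576) :
    traceRows (packedRows N) = N.trace := by
  rw [packedRows, traceRows_ofFn]
  exact Finset.sum_congr rfl fun i _ => sum_mul_pow_div_mod (hN i) i

lemma natMatrix_pow_le (c k : ℕ) (i j : Fin 7) : (natMatrix c ^ k) i j ≤ 7 ^ k := by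
  induction k generalizing i j with
  | zero =>
    rw [pow_zero, pow_zero, Matrix.one_apply]
    split_ifs <;> simp
  | succ k ih =>
    rw [pow_succ', Matrix.mul_apply, pow_succ']
    calc ∑ l, natMatrix c i l * (natMatrix c ^ k) l j ≤ ∑ _l : Fin 7, 1 * 7 ^ k :=
          Finset.sum_le_sum fun l _ => Nat.mul_le_mul (Bool.toNat_le _) (ih l j)
      _ = 7 * 7 ^ k := by simp

lemma scaledTraces_eq (c k m : ℕ) (h : m + k ≤ 7) :
    scaledTraces (rows c) k (4096 ^ m) (packedRows (natMatrix c ^ m)) =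
      (List.range k).map fun i => 4096 ^ (m + i + 1) * (natMatrix c ^ (m + i + 1)).trace := by
  induction k generalizing m with
  | zero => rfl
  | succ k ih =>
    have hlt : ∀ i j, (natMatrix c ^ (m + 1)) i j < 1048576 := fun i j =>
      ((natMatrix_pow_le c _ i j).trans (Nat.pow_le_pow_right (by norm_num) (by omega))).trans_lt
        (show 7 ^ 7 < 1048576 by norm_num)
    rw [scaledTraces, mulRows_packedRows, ← pow_succ', traceRows_packedRows hlt]
    simp only [Nat.mul_eq]
    rw [← pow_succ', ih (m + 1) (by omega), List.range_succ_eq_map, List.map_cons, List.map_map]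
    refine congrArg₂ List.cons (by rw [add_zero]) (List.map_congr_left fun i _ => ?_)
    rw [Function.comp_apply, Nat.succ_eq_add_one, add_right_comm m 1 i, ← add_assoc m i 1]

lemma powerSums_eq (c : ℕ) : powerSums c =
    (List.range 7).map fun i => 4096 ^ (i + 1) * (natMatrix c ^ (i + 1)).trace := by
  have : packedRows 1 = [1, 1048576, 1099511627776, 1152921504606846976,
      1208925819614629174706176, 1267650600228229401496703205376,
      1329227995784915872903807060280344576] := by
    decide +kernel
  rw [powerSums, ← this, ← pow_zero (natMatrix c)]
  simpa using scaledTraces_eq c 7 0 le_rfl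

/-- The scaled eigenvalues of a coded graph. -/
lemma exists_scaled_eigenvalues (c : ℕ) : ∃ x : Fin 7 → ℝ,
    (powerSums c).map (fun a : ℕ => (a : ℝ)) = (List.range 7).map (fun k => ∑ i, x i ^ (k + 1)) ∧
      4096 * energy (graph 7 c) = 2 * ∑ i, max (x i) 0 := by
  classical
  obtain ⟨y, hy, hE⟩ := exists_eigenvalues (graph 7 c)
  have hA : (graph 7 c).adjMatrix ℝ = (natMatrix c).map (Nat.castRingHom ℝ) := by
    ext i j
    simp only [SimpleGraph.adjMatrix_apply, natMatrix, graph_adj, Matrix.map_apply]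
    cases adj c i j <;> simp
  have hs : ∀ k, ∑ i, (4096 * y i) ^ k = ((4096 ^ k * (natMatrix c ^ k).trace : ℕ) : ℝ) := by
    intro k
    simp only [mul_pow, ← Finset.mul_sum]
    rw [hy, hA, ← RingHom.mapMatrix_apply, ← map_pow, RingHom.mapMatrix_apply,
      ← AddMonoidHom.map_trace (Nat.castRingHom ℝ)]
    simp
  refine ⟨fun i => 4096 * y i, ?_, ?_⟩
  · rw [powerSums_eq, List.map_map]
    exact List.map_congr_left fun k _ => (hs _).symm
  · have h1 : ∑ i, y i = 0 := by
      have := hy 1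
      simp only [pow_one, SimpleGraph.trace_adjMatrix] at this
      exact this
    rw [hE, sum_abs_eq_two_mul_sum_max h1, mul_left_comm, Finset.mul_sum]
    congr 2
    funext i
    rw [mul_max_of_nonneg _ _ (by norm_num), mul_zero]

/-! ### Correctness of Newton's identities -/

/-- The coefficients of `∏ i, (X - C (x i))`, from the leading coefficient downwards. -/
noncomputable def rootCoeff {n : ℕ} (x : Fin n → ℝ) (k : ℕ) : ℝ :=
  (-1) ^ k * (Finset.univ.val.map x).esymm k

lemma rootCoeff_zero {n : ℕ} (x : Fin n → ℝ) : rootCoeff x 0 = 1 := by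
  simp [rootCoeff, Multiset.esymm]

lemma coeff_prod_X_sub_C {n : ℕ} (x : Fin n → ℝ) {k : ℕ} (hk : k ≤ n) :
    (∏ i, (X - C (x i))).coeff k = rootCoeff x (n - k) := by
  have := Multiset.prod_X_sub_C_coeff (Finset.univ.val.map x) (k := k) (by simpa using hk)
  simp only [Multiset.map_map, Multiset.card_map, Finset.card_val, Finset.card_univ,
    Fintype.card_fin] at this
  exact this

lemma natDegree_prod_X_sub_C {n : ℕ} (x : Fin n → ℝ) : (∏ i, (X - C (x i))).natDegree = n := by
  simp [natDegree_prod_of_monic _ _ fun i _ => monic_X_sub_C (x i)]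

lemma rootCoeff_neg {n : ℕ} (x : Fin n → ℝ) (k : ℕ) :
    rootCoeff (fun i => -x i) k = (-1) ^ k * rootCoeff x k := by
  have : (Finset.univ.val.map fun i => -x i) = (Finset.univ.val.map x).map Neg.neg := by
    rw [Multiset.map_map]; rfl
  rw [rootCoeff, this, Multiset.esymm_neg, rootCoeff]

lemma mul_rootCoeff_add {n : ℕ} (x : Fin n → ℝ) (k : ℕ) :
    (k + 1 : ℕ) * rootCoeff x (k + 1) +
      ∑ i ∈ Finset.range (k + 1), rootCoeff x (k - i) * ∑ j, x j ^ (i + 1) = 0 := by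
  have h := congrArg (MvPolynomial.aeval x) (MvPolynomial.mul_esymm_eq_sum (Fin n) ℝ (k + 1))
  rw [Finset.sum_filter, Finset.Nat.sum_antidiagonal_eq_sum_range_succ_mk, Finset.sum_range_succ]
    at h
  simp only [map_mul, map_natCast, MvPolynomial.aeval_esymm_eq_multiset_esymm, map_pow, map_neg,
    map_one, lt_irrefl, if_false, add_zero, map_sum, apply_ite (MvPolynomial.aeval x), map_zero,
    MvPolynomial.psum, MvPolynomial.aeval_X] at h
  have h' : ∑ i ∈ Finset.range (k + 1), rootCoeff x (k - i) * ∑ j, x j ^ (i + 1) =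
      ∑ i ∈ Finset.range (k + 1), if i < k + 1 then
        (-1) ^ i * (Finset.univ.val.map x).esymm i * ∑ j, x j ^ (k + 1 - i) else 0 := by
    rw [← Finset.sum_range_reflect]
    refine Finset.sum_congr rfl fun i hi => ?_
    have hi := Finset.mem_range.1 hi
    rw [if_pos hi, rootCoeff, show k - (k + 1 - 1 - i) = i by omega,
      show k + 1 - 1 - i + 1 = k + 1 - i by omega]
  rw [h', rootCoeff, mul_left_comm, h, ← mul_assoc, ← pow_add,
    Odd.neg_one_pow ⟨k + 1, by ring⟩, neg_one_mul, neg_add_cancel]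

lemma dot_eq_sum (l : List ℤ) (ps : List ℕ) :
    (dot l ps : ℤ) = ∑ i ∈ Finset.range l.length, l.getD i 0 * (ps.getD i 0 : ℕ) := by
  induction l generalizing ps with
  | nil => rfl
  | cons c l ih =>
    cases ps with
    | nil => simp; rfl
    | cons p ps =>
      rw [List.length_cons, Finset.sum_range_succ', add_comm]
      exact congrArg (fun z => c * (p : ℤ) + z) (ih ps)

lemma getD_eq_rootCoeff {n m : ℕ} {x : Fin n → ℝ} {ps : List ℕ}
    (hps : ∀ i < m, (ps.getD i 0 : ℝ) = ∑ j, x j ^ (i + 1)) {l : List ℤ}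
    (hl : newtonCheck ps l = true) (hm : l.length ≤ m + 1) {i : ℕ} (hi : i < l.length) :
    (l.getD i 0 : ℝ) = rootCoeff x (l.length - 1 - i) := by
  induction l generalizing i with
  | nil => simp at hi
  | cons c l ih =>
    cases l with
    | nil =>
      simp only [newtonCheck, decide_eq_true_eq] at hl
      simp only [List.length_singleton, Nat.lt_one_iff] at hi
      subst hi hl
      simp [rootCoeff_zero]
    | cons d l =>
      simp only [newtonCheck, Bool.and_eq_true, decide_eq_true_eq] at hl
      have ih' := fun {i} => @ih hl.2 (by simp at hm ⊢; omega) i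
      cases i with
      | succ i =>
        have := ih' (i := i) (by simpa using hi)
        simpa [Nat.sub_sub, add_comm] using this
      | zero =>
        have h := congrArg (fun z : ℤ => (z : ℝ)) hl.1
        simp only [dot_eq_sum] at h
        push_cast at h
        have hsum : ∑ i ∈ Finset.range (d :: l).length,
            ((d :: l).getD i 0 : ℝ) * (ps.getD i 0 : ℝ) =
            ∑ i ∈ Finset.range (l.length + 1), rootCoeff x (l.length - i) * ∑ j, x j ^ (i + 1) := by
          refine Finset.sum_congr rfl fun i hi => ?_
          have hi := Finset.mem_range.1 hi
          rw [ih' hi, hps i (by simp at hi hm; omega)]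
          simp
        have h2 := mul_rootCoeff_add x l.length
        rw [hsum] at h
        have h3 : ((l.length + 1 : ℕ) : ℝ) * c =
            (l.length + 1 : ℕ) * rootCoeff x (l.length + 1) := by
          push_cast at h2 ⊢
          linarith
        simpa using mul_left_cancel₀ (by positivity) h3

/-- The polynomial with given coefficients, from the constant coefficient upwards. -/
noncomputable def polyOf (l : List ℝ) : ℝ[X] := l.foldr (fun a P => C a + X * P) 0

lemma polyOf_cons (a : ℝ) (l : List ℝ) : polyOf (a :: l) = C a + X * polyOf l := rfl

lemma coeff_polyOf (l : List ℝ) (k : ℕ) : (polyOf l).coeff k = l.getD k 0 := by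
  induction l generalizing k with
  | nil => simp [polyOf]
  | cons a l ih => cases k <;> simp [polyOf_cons, coeff_C, ih]

lemma length_newton (ps : List ℕ) (k : ℕ) : (newton ps k).length = k + 1 := by
  induction k with
  | zero => rfl
  | succ k ih => rw [newton, List.length_cons, ih]

lemma polyOf_coeffs {c : ℕ} {x : Fin 7 → ℝ} (hc : newtonCheck (powerSums c) (coeffs c) = true)
    (hx : (powerSums c).map (fun a : ℕ => (a : ℝ)) =
      (List.range 7).map fun k => ∑ i, x i ^ (k + 1)) :
    polyOf ((coeffs c).map fun a : ℤ => (a : ℝ)) = ∏ i, (X - C (x i)) := by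
  have hps : ∀ i < 7, ((powerSums c).getD i 0 : ℝ) = ∑ j, x j ^ (i + 1) := by
    intro i hi
    have := congrArg (fun l => l.getD i ((0 : ℕ) : ℝ)) hx
    simp only [List.getD_map] at this
    rw [this]
    simp [List.getD, hi]
  have hlen : (coeffs c).length = 8 := length_newton _ _
  ext k
  have h0 : ((coeffs c).map fun a : ℤ => (a : ℝ)).getD k 0 = ((coeffs c).getD k 0 : ℝ) := by
    simpa using List.getD_map (l := coeffs c) (n := k) (d := 0) (f := fun a : ℤ => (a : ℝ))
  rw [coeff_polyOf, h0]
  rcases le_or_gt k 7 with hk | hk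
  · rw [coeff_prod_X_sub_C _ hk, getD_eq_rootCoeff hps hc hlen.le (by omega), hlen]
  · rw [coeff_eq_zero_of_natDegree_lt (by rwa [natDegree_prod_X_sub_C]),
      List.getD_eq_default _ _ (by omega), Int.cast_zero]

/-! ### Descartes' rule of signs -/

lemma length_destutter'_eq_changes (s : SignType) (hs : s ≠ 0) (l : List SignType) :
    ((l.filter (· ≠ 0)).destutter' (· ≠ ·) s).length = changes s l + 1 := by
  induction l generalizing s with
  | nil => simp [changes]
  | cons t l ih =>
    have h₁ := ih 1 (by decide)
    have h₂ := ih (-1) (by decide)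
    cases s
    · exact absurd rfl hs
    · cases t
      · exact ih _ hs
      · exact h₂
      · exact congrArg (· + 1) h₁
    · cases t
      · exact ih _ hs
      · exact congrArg (· + 1) h₂
      · exact h₁

lemma length_destutter_sub_one_eq_changes (l : List SignType) :
    ((l.filter (· ≠ 0)).destutter (· ≠ ·)).length - 1 = changes .zero l := by
  induction l with
  | nil => rfl
  | cons t l ih =>
    cases t
    · exact ih
    · exact congrArg (· - 1) (length_destutter'_eq_changes (-1) (by decide) l)
    · exact congrArg (· - 1) (length_destutter'_eq_changes 1 (by decide) l)

lemma coeffList_prod_X_sub_C {n : ℕ} (x : Fin n → ℝ) :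
    (∏ i, (X - C (x i))).coeffList = (List.range (n + 1)).map (rootCoeff x) := by
  have hd : (∏ i, (X - C (x i))).degree.succ = n + 1 := by
    rw [degree_eq_natDegree (monic_prod_X_sub_C x Finset.univ).ne_zero, natDegree_prod_X_sub_C]
    rfl
  rw [coeffList, hd]
  refine List.ext_getElem (by simp) fun i h₁ h₂ => ?_
  simp only [List.length_map, List.length_range] at h₂
  simp only [List.getElem_map, List.getElem_reverse, List.getElem_range, List.length_range]
  rw [coeff_prod_X_sub_C _ (by omega)]
  congr 1
  omega

lemma roots_prod_X_sub_C_fin {n : ℕ} (x : Fin n → ℝ) :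
    (∏ i, (X - C (x i))).roots = Finset.univ.val.map x := by
  rw [← roots_multiset_prod_X_sub_C (Finset.univ.val.map x), Multiset.map_map]
  rfl

lemma card_pos_le_changes {n : ℕ} (x : Fin n → ℝ) :
    (Finset.univ.filter fun i => 0 < x i).card ≤
      changes .zero ((List.range (n + 1)).map fun k => SignType.sign (rootCoeff x k)) := by
  have h := roots_countP_pos_le_signVariations (P := ∏ i, (X - C (x i)))
  rw [signVariations, coeffList_prod_X_sub_C, roots_prod_X_sub_C_fin, Multiset.countP_map,
    List.map_map, length_destutter_sub_one_eq_changes] at h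
  exact h

/-! ### Correctness of the root counts -/

/-- The polynomial with given coefficients, from the constant coefficient upwards. -/
noncomputable def natPoly (p : List ℕ) : ℝ[X] := polyOf (p.map fun a : ℕ => (a : ℝ))

lemma natPoly_cons (a : ℕ) (p : List ℕ) : natPoly (a :: p) = C (a : ℝ) + X * natPoly p := rfl

lemma natPoly_mulAdd (t c : ℕ) (s : List ℕ) :
    natPoly (mulAdd t c s) = C (c : ℝ) + (X + C (t : ℝ)) * natPoly s := by
  induction s generalizing c with
  | nil => simp [mulAdd, natPoly, polyOf]
  | cons a s ih =>
    change natPoly ((c + t * a) :: mulAdd t a s) = _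
    rw [natPoly_cons, natPoly_cons, ih]
    simp only [Nat.cast_add, Nat.cast_mul, map_add, map_mul]
    ring

lemma natPoly_shift (t : ℕ) (p : List ℕ) :
    natPoly (shift t p) = (natPoly p).comp (X + C (t : ℝ)) := by
  induction p with
  | nil => simp [shift, natPoly, polyOf]
  | cons c p ih =>
    change natPoly (mulAdd t c (shift t p)) = _
    rw [natPoly_mulAdd, ih, natPoly_cons]
    simp

lemma length_mulAdd (t c : ℕ) (s : List ℕ) : (mulAdd t c s).length = s.length + 1 := by
  induction s generalizing c with
  | nil => rfl
  | cons a s ih => exact congrArg (· + 1) (ih a)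

lemma length_shift (t : ℕ) (p : List ℕ) : (shift t p).length = p.length := by
  induction p with
  | nil => rfl
  | cons c p ih =>
    change (mulAdd t c (shift t p)).length = _
    rw [length_mulAdd, ih, List.length_cons]

lemma natPoly_positivePart_sub_natPoly_negativePart (l : List ℤ) :
    natPoly (positivePart l) - natPoly (negativePart l) = polyOf (l.map fun a : ℤ => (a : ℝ)) := by
  induction l with
  | nil => simp [positivePart, negativePart, natPoly, polyOf]
  | cons z l ih =>
    have hz : ((z.toNat : ℕ) : ℝ) - ((-z).toNat : ℕ) = z := by
      exact_mod_cast congrArg (Int.cast : ℤ → ℝ) (Int.toNat_sub_toNat_neg z)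
    change natPoly (z.toNat :: positivePart l) - natPoly ((-z).toNat :: negativePart l) = _
    rw [natPoly_cons, natPoly_cons, List.map_cons, polyOf_cons, ← ih, ← hz, map_sub]
    ring

/-- The lists `p` and `q` give the coefficients of `∏ i, (X - C (x i))` as a difference. -/
structure Represents (p q : List ℕ) (x : Fin 7 → ℝ) : Prop where
  left : p.length = 8
  right : q.length = 8
  eq : natPoly p - natPoly q = ∏ i, (X - C (x i))

lemma Represents.shift {p q : List ℕ} {x : Fin 7 → ℝ} (h : Represents p q x) (t : ℕ) :
    Represents (shift t p) (shift t q) fun i => x i - t := by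
  refine ⟨by rw [length_shift, h.left], by rw [length_shift, h.right], ?_⟩
  rw [natPoly_shift, natPoly_shift, ← sub_comp, h.eq, prod_comp]
  refine Finset.prod_congr rfl fun i _ => ?_
  simp only [sub_comp, X_comp, C_comp, map_sub]
  ring

lemma compareSign_eq (a b : ℕ) : compareSign a b = SignType.sign ((a : ℝ) - b) := by
  rcases lt_trichotomy a b with h | rfl | h
  · rw [sign_neg (by simpa using h), compareSign, (show Nat.blt a b = true by rwa [Nat.blt_eq])]
    rfl
  · have : Nat.blt a a = false := by rw [Bool.eq_false_iff, Ne, Nat.blt_eq]; omega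
    rw [sub_self, sign_zero, compareSign, this]
    rfl
  · have h' : Nat.blt a b = false := by rw [Bool.eq_false_iff, Ne, Nat.blt_eq]; omega
    rw [sign_pos (by simpa using h), compareSign, h', (show Nat.blt b a = true by rwa [Nat.blt_eq])]
    rfl

lemma signs_eq {p q : List ℕ} (h : p.length = q.length) (acc : List SignType) :
    signs p q acc = (List.zipWith compareSign p q).reverse ++ acc := by
  induction p generalizing q acc with
  | nil => cases q <;> simp_all [signs]
  | cons a p ih =>
    cases q with
    | nil => simp at h
    | cons b q =>
      rw [List.zipWith_cons_cons, List.reverse_cons, List.append_assoc]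
      exact ih (by simpa using h) _

lemma Represents.signs {p q : List ℕ} {x : Fin 7 → ℝ} (h : Represents p q x) :
    signs p q [] = (List.range 8).map fun k => SignType.sign (rootCoeff x k) := by
  rw [signs_eq (h.left.trans h.right.symm), List.append_nil]
  refine List.ext_getElem (by simp [h.left, h.right]) fun i h₁ h₂ => ?_
  simp only [List.length_map, List.length_range] at h₂
  have hc := congrArg (fun P => P.coeff (7 - i)) h.eq
  simp only [coeff_sub, natPoly, coeff_polyOf] at hc
  rw [coeff_prod_X_sub_C _ (by omega), show 7 - (7 - i) = i by omega] at hc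
  have hp := h.left
  have hq := h.right
  rw [List.getD_eq_getElem _ _ (by simp; omega), List.getD_eq_getElem _ _ (by simp; omega)] at hc
  simp only [List.getElem_map] at hc
  simp only [List.getElem_reverse, List.getElem_zipWith, List.length_zipWith, hp, hq,
    List.getElem_map, List.getElem_range, compareSign_eq]
  rw [← hc]
  congr 3

lemma alternate_cons_cons (s t : SignType) (l : List SignType) :
    alternate (s :: t :: l) = s :: -t :: alternate l := by
  cases t <;> rfl

lemma Represents.alternate_signs {p q : List ℕ} {x : Fin 7 → ℝ} (h : Represents p q x) :
    alternate (GraphCode.signs p q []) =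
      (List.range 8).map fun k => SignType.sign (rootCoeff (fun i => -x i) k) := by
  have hr : List.range 8 = [0, 1, 2, 3, 4, 5, 6, 7] := rfl
  have he : ∀ k, Even k → SignType.sign (rootCoeff (fun i => -x i) k) =
      SignType.sign (rootCoeff x k) := fun k hk => by rw [rootCoeff_neg, hk.neg_one_pow, one_mul]
  have ho : ∀ k, Odd k → SignType.sign (rootCoeff (fun i => -x i) k) =
      -SignType.sign (rootCoeff x k) := fun k hk => by
    rw [rootCoeff_neg, hk.neg_one_pow, neg_one_mul, Left.sign_neg]
  rw [h.signs, hr]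
  simp only [List.map_cons, List.map_nil, alternate_cons_cons]
  rw [alternate]
  rw [he 0 (by decide), ho 1 (by decide), he 2 (by decide), ho 3 (by decide), he 4 (by decide),
    ho 5 (by decide), he 6 (by decide), ho 7 (by decide)]

lemma Represents.card_pos_le_upper {p q : List ℕ} {x : Fin 7 → ℝ} (h : Represents p q x) :
    (Finset.univ.filter fun i => 0 < x i).card ≤ upper p q := by
  rw [upper, h.signs]
  exact card_pos_le_changes x

lemma Represents.lower_le_card_nonneg {p q : List ℕ} {x : Fin 7 → ℝ} (h : Represents p q x) :
    lower p q ≤ (Finset.univ.filter fun i => 0 ≤ x i).card := by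
  have h₁ := card_pos_le_changes fun i => -x i
  have h₂ := Finset.card_filter_add_card_filter_not (s := Finset.univ) fun i => 0 ≤ x i
  rw [← h.alternate_signs] at h₁
  simp only [not_le, Left.neg_pos_iff, Finset.card_univ, Fintype.card_fin] at h₁ h₂
  rw [lower, Nat.sub_eq]
  omega

lemma sum_max_le_of_upperCheck {ds : List ℕ} {n : ℕ} {p q : List ℕ} {x : Fin 7 → ℝ}
    (h : Represents p q x) (hc : upperCheck ds n p q = true) : ∑ i, max (x i) 0 ≤ n := by
  induction ds generalizing n p q x with
  | nil =>
    have h0 := h.card_pos_le_upper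
    rw [Nat.eq_of_beq_eq_true hc, Nat.le_zero, Finset.card_eq_zero, Finset.filter_eq_empty_iff]
      at h0
    rw [Finset.sum_eq_zero fun i hi => max_eq_right (not_lt.1 (h0 hi))]
    positivity
  | cons d ds ih =>
    simp only [upperCheck, Bool.and_eq_true, Nat.ble_eq, Nat.mul_eq, Nat.sub_eq] at hc
    have h₁ := ih (h.shift d) hc.2
    rw [Nat.cast_sub hc.1, Nat.cast_mul] at h₁
    have h₂ : ∑ i, max (x i) 0 ≤ ∑ i, ((if 0 < x i then (d : ℝ) else 0) + max (x i - d) 0) := by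
      refine Finset.sum_le_sum fun i _ => ?_
      split_ifs with hi
      · refine max_le ?_ (by positivity)
        linarith [le_max_left (x i - d) 0]
      · rw [max_eq_right (not_lt.1 hi), zero_add]
        exact le_max_right _ _
    rw [Finset.sum_add_distrib, ← Finset.sum_filter, Finset.sum_const, nsmul_eq_mul] at h₂
    have h₃ : ((Finset.univ.filter fun i => 0 < x i).card : ℝ) * d ≤ upper p q * d :=
      mul_le_mul_of_nonneg_right (by exact_mod_cast h.card_pos_le_upper) (by positivity)
    linarith

lemma lowerSum_le_sum_max {ds : List ℕ} {p q : List ℕ} {x : Fin 7 → ℝ} (h : Represents p q x) :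
    (lowerSum ds p q : ℝ) ≤ ∑ i, max (x i) 0 := by
  induction ds generalizing p q x with
  | nil =>
    rw [lowerSum, Nat.cast_zero]
    exact Finset.sum_nonneg fun i _ => le_max_right _ _
  | cons d ds ih =>
    have h₁ := ih (h.shift d)
    have h₂ : ∑ i, ((if 0 ≤ x i - d then (d : ℝ) else 0) + max (x i - d) 0) ≤
        ∑ i, max (x i) 0 := by
      refine Finset.sum_le_sum fun i _ => ?_
      split_ifs with hi
      · rw [max_eq_left hi, add_sub_cancel]
        exact le_max_left _ _
      · rw [max_eq_right (not_le.1 hi).le, zero_add]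
        exact le_max_right _ _
    rw [Finset.sum_add_distrib, ← Finset.sum_filter, Finset.sum_const, nsmul_eq_mul] at h₂
    have h₃ : (lower (GraphCode.shift d p) (GraphCode.shift d q) : ℝ) * d ≤
        (Finset.univ.filter fun i => 0 ≤ x i - d).card * d :=
      mul_le_mul_of_nonneg_right (by exact_mod_cast (h.shift d).lower_le_card_nonneg)
        (by positivity)
    rw [lowerSum, Nat.add_eq, Nat.mul_eq, Nat.cast_add, Nat.cast_mul]
    linarith

lemma represents_coeffs {c : ℕ} {x : Fin 7 → ℝ} (hc : newtonCheck (powerSums c) (coeffs c) = true)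
    (hx : (powerSums c).map (fun a : ℕ => (a : ℝ)) =
      (List.range 7).map fun k => ∑ i, x i ^ (k + 1)) :
    Represents (positivePart (coeffs c)) (negativePart (coeffs c)) x := by
  have hlen : (coeffs c).length = 8 := length_newton _ _
  refine ⟨by rw [positivePart, List.length_map, hlen], by rw [negativePart, List.length_map, hlen],
    ?_⟩
  rw [natPoly_positivePart_sub_natPoly_negativePart, polyOf_coeffs hc hx]

lemma energy_lt_of_energyCheck {c : ℕ} {us ls : List ℕ} (h : energyCheck c us ls = true) :
    energy (graph 7 c) < energy (graph 7 c)ᶜ := by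
  simp only [energyCheck, Bool.and_eq_true, Nat.blt_eq, Nat.sub_eq] at h
  obtain ⟨h₁, h₂, hn, hu⟩ := h
  rw [← graph_xor_fullCode]
  change _ < energy (graph 7 (c ^^^ 2097151))
  obtain ⟨x, hx, hE⟩ := exists_scaled_eigenvalues c
  obtain ⟨y, hy, hE'⟩ := exists_scaled_eigenvalues (c ^^^ 2097151)
  have hxu := sum_max_le_of_upperCheck (represents_coeffs h₁ hx) hu
  have hyl := lowerSum_le_sum_max (ds := ls) (represents_coeffs h₂ hy)
  rw [Nat.cast_pred hn] at hxu
  linarith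

/-! ### The exceptional pair -/

lemma energy_eq_of_roots {c : ℕ} {l : List ℝ}
    (hc : newtonCheck (powerSums c) (coeffs c) = true)
    (hl : polyOf ((coeffs c).map fun a : ℤ => (a : ℝ)) = (l.map fun a => X - C a).prod) :
    4096 * energy (graph 7 c) = 2 * (l.map fun a => max a 0).sum := by
  obtain ⟨x, hx, hE⟩ := exists_scaled_eigenvalues c
  have hroots := congrArg roots ((polyOf_coeffs hc hx).symm.trans hl)
  rw [roots_prod_X_sub_C_fin, ← Multiset.prod_coe, ← Multiset.map_coe,
    roots_multiset_prod_X_sub_C] at hroots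
  have := congrArg (fun s => (Multiset.map (fun a => max a 0) s).sum) hroots
  simp only [Multiset.map_map, Multiset.map_coe, Multiset.sum_coe] at this
  rw [hE, ← this]
  rfl

lemma energy_exceptional : energy (graph 7 1927968) = energy (graph 7 1927968)ᶜ := by
  have hr : √(17 : ℝ) * √17 = 17 := Real.mul_self_sqrt (by norm_num)
  have h : ∀ t : ℝ, (t - (6144 + 2048 * √17)) * (t - (6144 - 2048 * √17)) =
      t ^ 2 - 12288 * t - 33554432 := fun t => by linear_combination (-4194304) * hr
  have h₁ := energy_eq_of_roots (c := 1927968)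
    (l := [6144 + 2048 * √17, 6144 - 2048 * √17, 0, 4096, -4096, -4096, -8192])
    (by decide +kernel) (by
      rw [show GraphCode.coeffs 1927968 = [0, 18889465931478580854784, 13835058055282163712,
          1407374883553280, -824633720832, -167772160, 0, 1] by decide +kernel]
      refine Polynomial.funext fun t => ?_
      simp [polyOf]
      linear_combination -t * (t - 4096) * (t + 4096) ^ 2 * (t + 8192) * h t)
  have h₂ := energy_eq_of_roots (c := 1927968 ^^^ fullCode 7)
    (l := [6144 + 2048 * √17, 6144 - 2048 * √17, 0, 0, 4096, -8192, -8192])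
    (by decide +kernel) (by
      rw [show GraphCode.coeffs (1927968 ^^^ fullCode 7) = [0, 0, 9223372036854775808,
          3377699720527872, -687194767360, -184549376, 0, 1] by decide +kernel]
      refine Polynomial.funext fun t => ?_
      simp [polyOf]
      linear_combination -t ^ 2 * (t - 4096) * (t + 8192) ^ 2 * h t)
  rw [← graph_xor_fullCode]
  refine mul_left_cancel₀ (by norm_num : (4096 : ℝ) ≠ 0) (h₁.trans (Eq.trans ?_ h₂.symm))
  simp

lemma not_nonempty_iso_compl (G : SimpleGraph (Fin 7)) : ¬ Nonempty (G ≃g Gᶜ) := by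
  classical
  rintro ⟨e⟩
  have h₁ := G.sum_degrees_eq_twice_card_edges
  have h₂ := Gᶜ.sum_degrees_eq_twice_card_edges
  have h₃ : ∑ v, G.degree v + ∑ v, Gᶜ.degree v = 42 := by
    have : ∀ v, G.degree v + Gᶜ.degree v = 6 := fun v => by
      have := G.degree_lt_card_verts v
      rw [SimpleGraph.degree_compl]
      rw [Fintype.card_fin] at this ⊢
      omega
    simp [← Finset.sum_add_distrib, this]
  rw [h₁, h₂, e.card_edgeFinset_eq] at h₃
  omega

lemma nonempty_iso_exceptional {G : SimpleGraph (Fin 7)} (hG : energy G = energy Gᶜ) :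
    Nonempty (G ≃g graph 7 1927968) ∨ Nonempty (G ≃g (graph 7 1927968)ᶜ) := by
  obtain ⟨c, hc, h⟩ := exists_iso_memPairs G
  have hE : energy (graph 7 c) = energy (graph 7 c)ᶜ := by
    rcases h with h | h
    · rw [← energy_congr h, ← energy_congr (nonempty_compl_iso h), hG]
    · rw [← energy_congr h, ← energy_congr (nonempty_compl_iso h), compl_compl, hG]
  rcases Bool.or_eq_true_iff.1 hc with hc | hc
  · obtain rfl := Nat.eq_of_beq_eq_true hc
    refine h.imp_right fun h => ?_
    have := nonempty_compl_iso h
    rwa [compl_compl] at this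
  · obtain ⟨us, ls, hcheck⟩ := Tree.exists_of_mem_of_all all_energyPairs hc
    exact absurd hE (energy_lt_of_energyCheck hcheck).ne

end GraphCode

/-- There is exactly one pair of complementary equienergetic graphs of order 7: there is a
7-vertex graph `D`, not isomorphic to its complement and equienergetic with its complement,
such that every 7-vertex graph `G` not isomorphic to `Gᶜ` with `E(G) = E(Gᶜ)` is isomorphic
to `D` or to `Dᶜ`. -/
theorem unique_complementary_equienergetic_pair_order_seven :
    ∃ D : SimpleGraph (Fin 7),
      ¬ Nonempty (D ≃g Dᶜ) ∧ energy D = energy Dᶜ ∧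
      ∀ G : SimpleGraph (Fin 7), ¬ Nonempty (G ≃g Gᶜ) → energy G = energy Gᶜ →
        Nonempty (G ≃g D) ∨ Nonempty (G ≃g Dᶜ) := by
  exact ⟨GraphCode.graph 7 1927968, GraphCode.not_nonempty_iso_compl _,
    GraphCode.energy_exceptional, fun _ _ hG => GraphCode.nonempty_iso_exceptional hG⟩
end

section
/- There exist nineteen simple graphs G_1, …, G_19, each on 9 vertices, pairwise non-isomorphic and with G_i not isomorphic to the complement of G_j for all i ≠ j, such that each G_i is cospectral with its complement but not isomorphic to its complement. -/
open Polynomial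

open SimpleGraph Matrix

section Charpoly

variable {n R : Type*} [Fintype n] [DecidableEq n] [CommRing R] [IsDomain R]

theorem Matrix.charpoly_eq_of_mul_eq_mul {A B P : Matrix n n R} (hP : P.det ≠ 0)
    (h : A * P = P * B) : A.charpoly = B.charpoly := by
  have hmul : A.charmatrix * P.map C = P.map C * B.charmatrix := by
    have hmap := congr_arg (fun M : Matrix n n R => M.map (C : R →+* R[X])) h
    simp only [Matrix.map_mul] at hmap
    simp only [charmatrix, sub_mul, mul_sub, RingHom.mapMatrix_apply, hmap,
      (scalar_commute (X : R[X]) (fun _ => Commute.all _ _) (P.map C)).eq]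
  have hdet := congr_arg det hmul
  rw [det_mul, det_mul, mul_comm] at hdet
  refine mul_left_cancel₀ ?_ hdet
  rw [← RingHom.mapMatrix_apply, ← RingHom.map_det]
  exact C_ne_zero.2 hP

theorem Matrix.det_ne_zero_of_mul_eq_smul_one {P Q : Matrix n n R} {d : R} (hd : d ≠ 0)
    (h : P * Q = d • 1) : P.det ≠ 0 := by
  have hdet := congr_arg det h
  rw [det_mul, det_smul, det_one, mul_one] at hdet
  exact left_ne_zero_of_mul (hdet ▸ pow_ne_zero _ hd)

end Charpoly

theorem adjMat_charpoly {V : Type*} [Fintype V] [DecidableEq V] (G : SimpleGraph V)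
    [DecidableRel G.Adj] :
    (adjMat G).charpoly = (G.adjMatrix ℤ).charpoly.map (Int.castRingHom ℝ) := by
  rw [← charpoly_map]
  congr 1
  ext u v
  simp [adjMat, adjMatrix_apply]

/-- The sum over all pairs of vertices of the cube of the number of walks of length three
between them. -/
def walkCubeSum {V : Type*} [Fintype V] (G : SimpleGraph V) [DecidableRel G.Adj] : ℕ :=
  ∑ u, ∑ v, (G.adjMatrix ℕ * G.adjMatrix ℕ * G.adjMatrix ℕ) u v ^ 3

theorem walkCubeSum_eq_of_iso {V W : Type*} [Fintype V] [Fintype W]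
    {G : SimpleGraph V} {H : SimpleGraph W} [DecidableRel G.Adj] [DecidableRel H.Adj]
    (e : G ≃g H) : walkCubeSum G = walkCubeSum H := by
  have hadj : G.adjMatrix ℕ = (H.adjMatrix ℕ).submatrix e.toEquiv e.toEquiv := by
    ext u v
    simp [adjMatrix_apply, e.map_adj_iff]
  simp only [walkCubeSum, hadj, submatrix_mul_equiv, submatrix_apply]
  rw [← e.toEquiv.sum_comp]
  exact Fintype.sum_congr _ _ fun u => e.toEquiv.sum_comp
    fun v => (H.adjMatrix ℕ * H.adjMatrix ℕ * H.adjMatrix ℕ) (e.toEquiv u) v ^ 3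

/-- The neighbourhoods of the nineteen graphs, each encoded as a bit mask. -/
def nbhdMask : Fin 19 → Fin 9 → ℕ :=
  ![![480, 224, 288, 448, 448, 7, 411, 347, 221],
    ![464, 416, 448, 448, 385, 2, 397, 351, 223],
    ![496, 480, 320, 128, 385, 387, 263, 315, 247],
    ![464, 480, 480, 384, 65, 390, 23, 303, 175],
    ![464, 224, 224, 256, 449, 390, 407, 119, 121],
    ![464, 416, 32, 448, 449, 390, 409, 123, 123],
    ![432, 224, 288, 448, 65, 391, 410, 363, 237],
    ![368, 432, 448, 128, 195, 259, 405, 350, 231],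
    ![368, 464, 160, 448, 387, 261, 395, 94, 123],
    ![432, 464, 224, 320, 131, 261, 398, 343, 235],
    ![496, 432, 352, 320, 131, 135, 269, 307, 207],
    ![112, 432, 480, 448, 131, 135, 269, 318, 206],
    ![368, 432, 224, 192, 259, 263, 397, 334, 243],
    ![240, 464, 480, 352, 131, 269, 271, 23, 110],
    ![232, 496, 160, 449, 258, 391, 267, 47, 122],
    ![232, 496, 288, 449, 130, 391, 267, 59, 110],
    ![424, 112, 480, 321, 386, 135, 270, 309, 221],
    ![408, 368, 480, 193, 259, 134, 270, 301, 215],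
    ![472, 368, 480, 193, 387, 262, 15, 29, 55]]

/-- Nineteen graphs on nine vertices that are cospectral with their complements. -/
def cospectralGraph (i : Fin 19) : SimpleGraph (Fin 9) where
  Adj u v := (nbhdMask i u).testBit v
  symm := by
    constructor
    revert i
    decide +kernel
  loopless := by
    constructor
    revert i
    decide +kernel

instance (i : Fin 19) : DecidableRel (cospectralGraph i).Adj := fun u v =>
  inferInstanceAs (Decidable ((nbhdMask i u).testBit v = true))

/-- Matrices intertwining the adjacency matrices of the graphs and of their complements. -/
def intertwiner : Fin 19 → Matrix (Fin 9) (Fin 9) ℤ :=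
  ![!![-1, 0, 0, 0, 0, -1, 2, 0, 1;
     -3, 1, -1, 1, 1, 0, 0, 1, 0;
     -3, -1, 1, 1, 1, 0, 0, 1, 0;
     4, -2, -2, 0, 0, 0, 0, 0, 0;
     4, -1, -1, -1, -1, -1, 0, 1, 1;
     4, -2, -1, -2, -2, 3, 1, 1, 1;
     -1, 0, 1, 1, -1, 0, -1, -1, 0;
     -1, 0, 1, -1, 1, 0, -1, -1, 0;
     -2, 2, 0, 0, 0, 0, 0, 0, -2],
   !![-3, -1, 1, 1, -2, -1, 0, -1, -1;
     0, -2, -2, -2, 0, 2, 0, 2, 2;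
     -1, 0, 0, 0, -2, -1, 0, -1, 0;
     -1, 0, 0, 0, -2, -1, 0, 0, -1;
     1, 0, -2, -2, 1, -1, -1, 0, 0;
     -2, -2, 0, 0, 0, 2, 0, 2, 2;
     1, -1, -2, -2, 3, -2, -3, -1, -1;
     -1, -1, 0, -2, -2, -1, 0, 0, 0;
     -1, -1, -2, 0, -2, -1, 0, 0, 0],
   !![0, -1, 1, -1, -1, 0, 0, 0, 0;
     -1, 0, 0, 0, 0, -1, 0, -1, 1;
     1, 0, 0, 0, 0, -1, 0, -1, -1;
     -1, 0, 0, 0, 0, 1, 0, -1, -1;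
     -1, 0, 0, 0, 0, -1, 0, 1, -1;
     0, -1, -1, 1, -1, 0, 0, 0, 0;
     0, 0, 0, 0, 0, 0, -2, 0, 0;
     0, -1, -1, -1, 1, 0, 0, 0, 0;
     0, 1, -1, -1, -1, 0, 0, 0, 0],
   !![0, 1, 1, -1, 0, -1, 3, -1, -1;
     1, -1, -1, 1, 2, -1, 0, 0, -1;
     1, -1, -1, 1, 2, -1, 0, -1, 0;
     0, 0, 0, -2, 2, 2, 0, -1, -1;
     2, -1, -1, 1, 0, -1, -1, 1, 1;
     0, 2, 2, -3, -1, 1, 2, 0, 0;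
     -2, 1, 1, -1, 0, 3, -1, 0, 0;
     0, 1, -1, 2, -1, 0, -1, 1, 1;
     0, -1, 1, 2, -1, 0, -1, 1, 1],
   !![0, -1, 0, 1, 0, 1, 1, 2, 1;
     2, 1, 1, 0, -2, 0, 0, 0, 0;
     -2, 1, 1, 0, 2, 0, 0, 0, 0;
     2, 1, 1, -2, 2, 1, -2, -5, -1;
     0, 0, -1, 1, 0, 1, 1, 2, 1;
     2, 1, 1, 0, 2, -1, -2, -3, -1;
     0, 0, 0, 2, 0, -1, 2, 1, 1;
     0, 0, 0, 0, 0, 2, 0, 2, 2;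
     1, 2, 2, 0, 1, 0, -1, -3, -3],
   !![-1, -2, -1, -2, -1, -2, 0, 1, 0;
     0, -2, -2, 0, 0, 0, 0, -2, -2;
     0, 0, 0, 0, 0, 0, 0, -2, -2;
     0, -2, -1, -1, 0, -2, -1, 0, 0;
     -1, -2, -1, -2, -1, -2, 0, 0, 1;
     0, 0, -4, 0, 0, 0, 0, -2, -2;
     -2, -1, -2, -1, -2, -2, -1, 1, 1;
     -4, -1, -1, -2, 0, 0, -2, -1, -1;
     0, -1, -1, -2, -4, 0, -2, -1, -1],
   !![-1, 0, 0, 2, 0, 1, 1, 1, -1;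
     0, 1, 3, -2, -1, -2, 0, 5, -1;
     1, -2, 0, 2, -1, 0, 2, -2, 3;
     1, 3, -3, 1, 0, 2, -1, -1, 1;
     0, -1, 0, -1, 1, 2, 0, 1, 1;
     2, 2, 0, -2, 1, 0, 1, 2, -3;
     -1, 1, 0, 0, 2, -1, 1, 0, 1;
     1, -4, 3, 3, 1, -2, -1, 0, 2;
     0, 3, 0, 0, 0, 3, 0, -3, 0],
   !![0, -2, -2, -2, 0, 2, -2, 0, 2;
     -2, 2, -2, 0, 0, 0, -2, -4, 0;
     1, -2, -1, 1, -3, 1, -1, 0, -3;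
     0, 2, -2, 2, -2, -2, 0, 0, 0;
     -1, -2, 1, 1, -1, -3, -1, 0, -1;
     -1, -4, -1, 1, 1, -1, 1, -2, 1;
     0, 0, -2, -2, 0, 0, -2, 2, -2;
     2, 0, 0, -4, -2, -2, 2, -2, 0;
     -4, 0, 0, -2, 0, -2, 0, 2, 0],
   !![-2, 0, 0, 0, 0, 0, 0, 0, 0;
     0, 0, 0, -1, -1, 0, 0, 1, -1;
     0, 0, 0, 1, -1, 0, 0, -1, -1;
     0, -1, 1, 0, 0, -1, -1, 0, 0;
     0, -1, -1, 0, 0, 1, -1, 0, 0;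
     0, 0, 0, -1, 1, 0, 0, -1, -1;
     0, 0, 0, -1, -1, 0, 0, -1, 1;
     0, 1, -1, 0, 0, -1, -1, 0, 0;
     0, -1, -1, 0, 0, -1, 1, 0, 0],
   !![0, 0, 0, -1, -1, 1, 0, 0, -1;
     0, -2, 0, 0, 0, 0, 0, 0, 0;
     0, 0, 0, 0, 0, 0, -2, 0, 0;
     0, 0, 0, 0, 0, 0, 0, -2, 0;
     -1, 0, -1, 0, 1, 0, 0, 0, -1;
     0, 0, 0, 1, -1, -1, 0, 0, -1;
     -1, 0, 1, -1, 0, -1, 0, 0, 0;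
     -1, 0, -1, 0, -1, 0, 0, 0, 1;
     1, 0, -1, -1, 0, -1, 0, 0, 0],
   !![0, 0, 0, 1, 1, 0, -1, 1, 0;
     0, 2, 0, 0, 0, 0, 0, 0, 0;
     0, 0, 0, -1, 1, 0, 1, 1, 0;
     1, 0, -1, 0, 0, 1, 0, 0, 1;
     1, 0, 1, 0, 0, -1, 0, 0, 1;
     0, 0, 0, 1, -1, 0, 1, 1, 0;
     -1, 0, 1, 0, 0, 1, 0, 0, 1;
     1, 0, 1, 0, 0, 1, 0, 0, -1;
     0, 0, 0, 1, 1, 0, 1, -1, 0],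
   !![1, 0, -2, -4, -3, 0, 5, 6, -2;
     -1, -1, -1, 1, 0, -1, -3, -3, 0;
     -3, 1, -1, -1, -1, -1, -1, 1, 0;
     -3, 0, 0, 0, 0, -1, -3, 1, 1;
     -2, 1, -1, -1, -1, -1, -1, 2, 1;
     -2, 0, -1, -1, -1, -1, 0, 2, -1;
     2, -1, -4, -2, -1, -2, 4, 2, -2;
     2, -4, 0, -1, 0, -1, -1, -6, -2;
     -2, -1, 1, -1, -2, 1, -3, -2, 0],
   !![1, 0, 0, 0, 0, 0, 0, 0, 0;
     1, -1, -1, 1, 1, -1, 1, -1, 1;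
     1, 1, 0, -1, 0, 0, 0, 1, -1;
     -1, 0, 0, 0, 0, 1, 0, 0, 1;
     -1, 0, 1, 0, 0, 0, 0, 0, 1;
     1, 1, 0, 0, -1, 0, 0, 1, -1;
     1, -1, -1, 1, 1, -1, 1, 0, 0;
     -1, 0, 1, 0, 0, 1, 0, 0, 0;
     -1, 1, 1, 0, 0, 1, -1, 0, 0],
   !![3, 2, -4, 2, -3, 3, -1, 0, -2;
     1, 2, -6, 4, 1, -3, 1, -2, 2;
     -5, -3, 9, -4, 6, -2, 1, -3, 1;
     1, 2, -2, 0, -5, 1, 1, 4, 0;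
     -3, 1, 11, -6, -6, 0, -3, 7, 1;
     -2, 3, -3, 2, 1, -1, 2, -1, -1;
     0, 2, 0, -2, -2, 0, 0, 2, 2;
     3, -2, -4, 4, 5, -1, 1, -6, -2;
     2, -5, 1, 0, 1, 3, -2, 1, -1],
   !![2, -1, 2, 0, 0, 1, -1, 2, -1;
     2, -1, 2, 1, -1, 2, 0, 1, -1;
     0, 0, 2, 1, -1, 0, 0, 1, -1;
     1, 0, 0, 1, 0, 0, 1, 1, 1;
     0, 0, -1, 1, 2, 0, 0, -1, 1;
     0, 2, -1, 1, 2, -1, 2, -1, 1;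
     -1, 1, 0, 0, 2, -1, 2, -1, 2;
     0, 1, 0, 0, 2, 1, 0, -1, 2;
     0, 1, 2, 0, 0, 1, 0, 2, -1],
   !![1, -1, 2, 0, 0, 1, 0, 0, 1;
     0, 1, 1, 1, 0, 0, 2, -1, 1;
     -1, 1, 0, 1, 1, -1, 1, -1, 1;
     1, 0, 0, 1, 0, 0, 1, 1, 1;
     1, -1, 1, 1, 0, 1, -1, 1, -1;
     2, 0, 0, 1, 1, 1, 0, 1, -1;
     0, 1, 0, 0, 2, -1, 1, 1, 0;
     -1, 2, 0, 0, 2, 0, 1, 0, 1;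
     1, 0, 2, 0, 0, 2, -1, 1, 0],
   !![-2, 0, 0, 0, 0, 0, 0, 0, 0;
     0, 0, 1, -2, 1, 1, -2, 1, -2;
     0, 1, 0, -2, 0, 1, -1, -1, 0;
     0, 0, -1, 0, 0, 1, -1, 0, -1;
     0, 0, -1, 1, -1, -2, 2, 0, -1;
     0, -1, 0, 2, -1, -1, 0, -2, 1;
     0, -1, 0, 1, 0, -2, 1, -2, 1;
     0, 0, -1, -1, 0, 0, -1, 1, 0;
     0, -1, 0, -1, -1, 0, 0, 1, 0],
   !![0, 0, 0, 0, 0, 0, -2, 0, 0;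
     0, -2, 0, 0, 0, 0, 0, 0, 0;
     0, 0, -1, 0, -1, 0, 0, 1, -1;
     0, 0, 1, 0, -1, 0, 0, -1, -1;
     -1, 0, -1, 1, 0, 0, 0, -1, 0;
     -1, 0, 0, -1, 1, 0, 0, 0, -1;
     1, 0, -1, -1, 0, 0, 0, -1, 0;
     0, 0, 0, 0, 0, -2, 0, 0, 0;
     -1, 0, 0, -1, -1, 0, 0, 0, 1],
   !![0, 1, 1, 0, 0, 1, -1, -1, 0;
     -1, 0, 0, -1, 0, 1, 1, 0, 1;
     -1, 1, 0, -1, 0, 1, 0, 0, 1;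
     1, 1, 1, 0, 0, 0, -1, -1, 0;
     0, 0, 0, 0, 1, 0, 0, 0, 0;
     0, -1, -1, 0, 0, 0, 1, 1, 1;
     1, 0, 0, 1, 0, -1, 0, 1, -1;
     1, 0, 1, 1, 0, -1, 0, 0, -1;
     0, -1, -1, 1, 0, 0, 1, 1, 0]]

/-- The inverses of the intertwining matrices, up to the factors `intertwinerScale`. -/
def intertwinerInv : Fin 19 → Matrix (Fin 9) (Fin 9) ℤ :=
  ![!![-8, -8, -4, -4, -4, -4, -10, -10, -8;
     -8, 0, -12, -12, -4, -4, -10, -10, -8;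
     -8, -16, 4, -12, -4, -4, -10, -10, -8;
     -8, -4, -2, -2, -10, -6, -3, -19, -12;
     -8, -4, -2, -2, -10, -6, -19, -3, -12;
     -8, 0, -4, -4, -12, 4, -6, -6, -8;
     8, -8, 0, 0, -8, 0, -8, -8, 0;
     -8, 0, 8, -8, 8, 0, -8, -8, 0;
     0, 8, -8, -8, 0, 0, 0, 0, -16],
   !![-8, 0, 0, 0, -12, -2, 4, 4, 4;
     2, 0, 6, 6, 12, 2, -4, -7, -7;
     -4, -3, 0, 0, -6, 2, 2, 5, -1;
     -4, -3, 0, 0, -6, 2, 2, -1, 5;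
     4, -3, -6, -6, 6, 1, -2, 1, 1;
     6, 12, 6, 6, 0, -6, 0, -9, -9;
     6, -3, -12, -12, 6, -3, -6, 6, 6;
     -6, -6, -6, 6, 0, 6, 0, 3, 3;
     -6, -6, 6, -6, 0, 6, 0, 3, 3],
   !![0, -1, 1, -1, -1, 0, 0, 0, 0;
     -1, 0, 0, 0, 0, -1, 0, -1, 1;
     1, 0, 0, 0, 0, -1, 0, -1, -1;
     -1, 0, 0, 0, 0, 1, 0, -1, -1;
     -1, 0, 0, 0, 0, -1, 0, 1, -1;
     0, -1, -1, 1, -1, 0, 0, 0, 0;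
     0, 0, 0, 0, 0, 0, -2, 0, 0;
     0, -1, -1, -1, 1, 0, 0, 0, 0;
     0, 1, -1, -1, -1, 0, 0, 0, 0],
   !![-3, 0, 0, 3, -4, 2, -5, 2, 2;
     -4, 1, 1, 1, -5, 3, -4, 2, 1;
     -4, 1, 1, 1, -5, 3, -4, 1, 2;
     0, 0, 0, 1, -1, 0, -1, 1, 1;
     1, 1, 1, -2, 2, 0, 3, -1, -1;
     3, -1, -1, 1, 3, -2, 2, 0, 0;
     7, -1, -1, -2, 8, -4, 7, -2, -2;
     4, 1, -1, -3, 6, -2, 6, -2, -2;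
     4, -1, 1, -3, 6, -2, 6, -2, -2],
   !![3, 3, 2, 1, 3, 1, -2, -4, -2;
     -2, 1, 1, 0, 2, 0, 0, 0, 0;
     2, 1, 1, 0, -2, 0, 0, 0, 0;
     -4, -5, -5, -2, -4, 0, 4, 7, 4;
     3, 2, 3, 1, 3, 1, -2, -4, -2;
     -1, -2, -2, 0, -1, -1, 1, 3, 2;
     3, 3, 3, 2, 3, -1, -1, -5, -2;
     3, 3, 3, 0, 3, 1, -3, -4, -2;
     -2, -1, -1, 0, -2, 0, 2, 3, 0],
   !![0, -1, -1, 2, 0, 1, -2, -1, 1;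
     0, -4, 2, 0, 0, 2, 0, 0, 0;
     0, 0, 2, 0, 0, -2, 0, 0, 0;
     -2, 3, 1, 0, -2, -2, 4, -1, -1;
     0, -1, -1, 2, 0, 1, -2, 1, -1;
     0, 2, -4, -2, 0, 0, -2, 1, 1;
     2, 1, 1, -4, 2, 0, 0, -1, -1;
     4, 0, -2, 0, -4, 0, 0, 0, 0;
     -4, 0, -2, 0, 4, 0, 0, 0, 0],
   !![-1, 0, 1, 1, 0, 2, -1, 1, 0;
     0, 1, 0, 1, -1, 0, 1, 0, 1;
     0, 1, 0, -1, 0, 0, 0, 1, 2;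
     2, 0, 0, 1, -1, 0, 0, 1, 0;
     0, -1, -1, 0, 1, 1, 2, 1, 0;
     1, 0, 0, 0, 2, 0, -1, 0, 1;
     1, 0, 2, -1, 0, 1, 1, -1, 0;
     1, 1, 0, 1, 1, 0, 0, 0, -1;
     -1, 1, 1, 1, 1, -1, 1, 0, 0],
   !![1, -4, -5, 2, 4, -1, 6, 3, -12;
     -3, 3, -3, 3, -3, -6, 0, 0, 0;
     0, 0, 0, -9, 9, -9, -9, 0, 0;
     -2, -1, 1, 5, 1, 2, -3, -6, -3;
     -7, 1, -10, -5, -1, 7, 12, -3, -6;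
     2, 1, 8, -5, -10, -2, -6, -3, 3;
     -8, -4, 4, 2, -14, 8, -3, 3, 6;
     2, -8, -1, 4, -1, -2, 3, -3, 3;
     12, -3, -6, 6, 3, -3, -9, 0, 0],
   !![-2, 0, 0, 0, 0, 0, 0, 0, 0;
     0, 0, 0, -1, -1, 0, 0, 1, -1;
     0, 0, 0, 1, -1, 0, 0, -1, -1;
     0, -1, 1, 0, 0, -1, -1, 0, 0;
     0, -1, -1, 0, 0, 1, -1, 0, 0;
     0, 0, 0, -1, 1, 0, 0, -1, -1;
     0, 0, 0, -1, -1, 0, 0, -1, 1;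
     0, 1, -1, 0, 0, -1, -1, 0, 0;
     0, -1, -1, 0, 0, -1, 1, 0, 0],
   !![0, 0, 0, 0, -1, 0, -1, -1, 1;
     0, -2, 0, 0, 0, 0, 0, 0, 0;
     0, 0, 0, 0, -1, 0, 1, -1, -1;
     -1, 0, 0, 0, 0, 1, -1, 0, -1;
     -1, 0, 0, 0, 1, -1, 0, -1, 0;
     1, 0, 0, 0, 0, -1, -1, 0, -1;
     0, 0, -2, 0, 0, 0, 0, 0, 0;
     0, 0, 0, -2, 0, 0, 0, 0, 0;
     -1, 0, 0, 0, -1, -1, 0, 1, 0],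
   !![0, 0, 0, 1, 1, 0, -1, 1, 0;
     0, 2, 0, 0, 0, 0, 0, 0, 0;
     0, 0, 0, -1, 1, 0, 1, 1, 0;
     1, 0, -1, 0, 0, 1, 0, 0, 1;
     1, 0, 1, 0, 0, -1, 0, 0, 1;
     0, 0, 0, 1, -1, 0, 1, 1, 0;
     -1, 0, 1, 0, 0, 1, 0, 0, 1;
     1, 0, 1, 0, 0, 1, 0, 0, -1;
     0, 0, 0, 1, 1, 0, 1, -1, 0],
   !![19, 22, 6, 0, -1, -13, -17, 4, -16;
     22, 25, 19, -2, -6, -18, -21, 4, -20;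
     -10, -11, -15, -12, 18, 22, -1, 3, 3;
     -24, -18, -27, -15, 19, 34, 14, -5, 16;
     22, 17, 29, 22, -30, -36, -10, 2, -16;
     14, 11, 20, 17, -28, -29, -1, -4, -2;
     -30, -33, -19, -10, 15, 27, 23, -4, 22;
     7, 7, 0, 4, -3, -3, -5, 0, -5;
     -26, -29, -19, -4, 17, 16, 22, -4, 21],
   !![2, 0, 0, 0, 0, 0, 0, 0, 0;
     -2, 2, 1, 0, 0, 1, -1, 0, 1;
     1, 0, 0, -1, 1, 0, 0, 1, 0;
     0, 0, -1, 0, 0, 1, 1, 0, 1;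
     0, 0, 1, 0, 0, -1, 1, 0, 1;
     1, 0, 0, 1, -1, 0, 0, 1, 0;
     -2, 2, 1, 0, 0, 1, -1, 2, -1;
     1, -2, 0, 1, 1, 0, 2, -1, 0;
     1, 0, 0, 1, 1, 0, 0, -1, 0],
   !![39, 42, 52, 88, 97, 71, 219, 210, 102;
     101, 64, 70, 14, 97, 159, 209, 126, 100;
     148, 137, 165, 130, 97, 63, 70, 103, 111;
     197, 242, 198, 156, 97, 95, -13, 46, 172;
     -4, 33, 27, -14, 97, 229, 276, 165, 191;
     207, 111, 179, 94, 0, 56, 73, -27, 131;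
     64, 54, 150, 224, 0, 22, 46, 76, 48;
     -59, 26, -14, 36, 97, 201, 191, 130, 174;
     151, 185, 169, 92, 0, -36, 57, -45, 89],
   !![2, 0, 0, 0, -2, 2, -1, 1, -2;
     0, -1, 1, 0, -2, 2, -2, 2, 0;
     1, 0, 2, -1, -1, 0, 1, 1, -1;
     -1, 0, 2, 1, 2, 0, -1, 0, 0;
     1, 0, -1, -1, 2, 0, 1, -1, 1;
     -2, 2, -2, 0, 1, -1, 0, 0, 2;
     -1, 2, -2, 0, 0, 0, 2, -2, 1;
     0, -1, -1, 2, 1, -1, 0, -1, 2;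
     0, -1, 1, 2, -1, -1, 0, 2, -1],
   !![0, -1, 3, 0, -5, 3, 1, -4, 3;
     -3, 0, 3, 0, -4, 1, 1, -3, 5;
     0, 1, 1, -1, 0, -1, 2, -2, 2;
     -1, 0, 2, 1, 2, 0, -1, 0, 0;
     2, -1, 0, -1, 1, 1, 0, 2, -2;
     1, 1, -4, 0, 3, 0, -3, 5, -3;
     1, 3, -5, 0, 3, -1, 0, 3, -4;
     -1, 0, -2, 2, 2, -2, 1, 1, 0;
     1, -2, 2, 2, -2, 0, -1, 0, 1],
   !![-2, 0, 0, 0, 0, 0, 0, 0, 0;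
     0, 0, 1, -2, 1, 1, -2, 1, -2;
     0, 1, 0, -2, 0, 1, -1, -1, 0;
     0, 0, -1, 0, 0, 1, -1, 0, -1;
     0, 0, -1, 1, -1, -2, 2, 0, -1;
     0, -1, 0, 2, -1, -1, 0, -2, 1;
     0, -1, 0, 1, 0, -2, 1, -2, 1;
     0, 0, -1, -1, 0, 0, -1, 1, 0;
     0, -1, 0, -1, -1, 0, 0, 1, 0],
   !![0, 0, 0, 0, -1, -1, 1, 0, -1;
     0, -2, 0, 0, 0, 0, 0, 0, 0;
     0, 0, -1, 1, -1, 0, -1, 0, 0;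
     0, 0, 0, 0, 1, -1, -1, 0, -1;
     0, 0, -1, -1, 0, 1, 0, 0, -1;
     0, 0, 0, 0, 0, 0, 0, -2, 0;
     -2, 0, 0, 0, 0, 0, 0, 0, 0;
     0, 0, 1, -1, -1, 0, -1, 0, 0;
     0, 0, -1, -1, 0, -1, 0, 0, 1],
   !![0, 1, -1, 1, 0, 0, 1, -1, 0;
     -1, 0, 1, 1, 0, -1, 0, 0, 1;
     1, 0, 0, -1, 0, 1, 0, 1, -1;
     0, -1, 1, 0, 0, 0, -1, 1, 1;
     0, 0, 0, 0, 1, 0, 0, 0, 0;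
     1, 1, -1, 0, 0, 0, 1, -1, 0;
     -1, 1, 0, 1, 0, -1, 0, 0, 1;
     1, 0, 0, -1, 0, 1, 1, 0, -1;
     0, -1, 1, 0, 0, 1, -1, 1, 0]]

/-- The scalars by which `intertwiner i * intertwinerInv i` differs from the identity. -/
def intertwinerScale : Fin 19 → ℤ :=
  ![32, 12, 4, 2, 4, 8, 9, 54, 4, 4, 4, 13, 2, 388, 5, 5, 4, 4, 1]

theorem intertwiner_mul_inv (i : Fin 19) :
    intertwiner i * intertwinerInv i = intertwinerScale i • 1 := by
  revert i
  decide +kernel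

theorem intertwinerScale_ne_zero (i : Fin 19) : intertwinerScale i ≠ 0 := by
  revert i
  decide

theorem adjMatrix_mul_intertwiner (i : Fin 19) :
    (cospectralGraph i).adjMatrix ℤ * intertwiner i =
      intertwiner i * (cospectralGraph i)ᶜ.adjMatrix ℤ := by
  revert i
  decide +kernel

theorem adjMat_charpoly_eq_compl (i : Fin 19) :
    (adjMat (cospectralGraph i)).charpoly = (adjMat (cospectralGraph i)ᶜ).charpoly := by
  rw [adjMat_charpoly, adjMat_charpoly, charpoly_eq_of_mul_eq_mul
    (det_ne_zero_of_mul_eq_smul_one (intertwinerScale_ne_zero i) (intertwiner_mul_inv i))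
    (adjMatrix_mul_intertwiner i)]

/-- The values of `walkCubeSum` on the graphs. -/
def walkCubeSumValue : Fin 19 → ℕ :=
  ![128628, 191832, 150576, 107268, 111756, 123504, 104628, 102096, 79848, 87384, 83244, 64008,
    76068, 60048, 74736, 70488, 59472, 58560, 53832]

/-- The values of `walkCubeSum` on the complements of the graphs. -/
def walkCubeSumComplValue : Fin 19 → ℕ :=
  ![127152, 187728, 150852, 104724, 115416, 126144, 105132, 105192, 79248, 86304, 83256, 63672,
    77172, 60132, 76512, 72408, 58572, 57672, 54072]

theorem walkCubeSum_cospectralGraph (i : Fin 19) :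
    walkCubeSum (cospectralGraph i) = walkCubeSumValue i := by
  revert i
  decide +kernel

theorem walkCubeSum_cospectralGraph_compl (i : Fin 19) :
    walkCubeSum (cospectralGraph i)ᶜ = walkCubeSumComplValue i := by
  revert i
  decide +kernel

theorem walkCubeSumValue_injective : Function.Injective walkCubeSumValue := by
  decide +kernel

theorem walkCubeSumValue_ne_complValue (i j : Fin 19) :
    walkCubeSumValue i ≠ walkCubeSumComplValue j := by
  revert i j
  decide +kernel

theorem cospectralGraph_not_iso {i j : Fin 19} (hij : i ≠ j) :
    ¬ Nonempty (cospectralGraph i ≃g cospectralGraph j) := by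
  rintro ⟨e⟩
  have hsum := walkCubeSum_eq_of_iso e
  rw [walkCubeSum_cospectralGraph, walkCubeSum_cospectralGraph] at hsum
  exact hij (walkCubeSumValue_injective hsum)

theorem cospectralGraph_not_iso_compl (i j : Fin 19) :
    ¬ Nonempty (cospectralGraph i ≃g (cospectralGraph j)ᶜ) := by
  rintro ⟨e⟩
  have hsum := walkCubeSum_eq_of_iso e
  rw [walkCubeSum_cospectralGraph, walkCubeSum_cospectralGraph_compl] at hsum
  exact walkCubeSumValue_ne_complValue i j hsum

/-- There are nineteen graphs on 9 vertices, pairwise non-isomorphic and with `Gᵢ` not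
isomorphic to the complement of `Gⱼ` for `i ≠ j`, each of which is cospectral with its
complement but not isomorphic to its complement. -/
theorem nineteen_noniso_cospectral_compl_order_nine :
    ∃ G : Fin 19 → SimpleGraph (Fin 9),
      (∀ i j, i ≠ j →
        ¬ Nonempty (G i ≃g G j) ∧ ¬ Nonempty (G i ≃g (G j)ᶜ)) ∧
      (∀ i, (adjMat (G i)).charpoly = (adjMat (G i)ᶜ).charpoly ∧
        ¬ Nonempty (G i ≃g (G i)ᶜ)) :=
  ⟨cospectralGraph,
    fun i j hij => ⟨cospectralGraph_not_iso hij, cospectralGraph_not_iso_compl i j⟩,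
    fun i => ⟨adjMat_charpoly_eq_compl i, cospectralGraph_not_iso_compl i i⟩⟩
end
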